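/- arXiv:0704.1041 — 4 statements merged into one kernel-verified Lean document; each statement's English description precedes it below -/
import Mathlib

section
/- For every positive integer N, the volume Ω_N of the unit ball in ℝ^N satisfies 0 ≤ Ω_N ≤ 2 · 20^(N/2) / N^((N+1)/2). -/
open MeasureTheory

/-- An elementary form of `(1 + 2 / n) ^ (n + 1) ≤ 10`. -/
theorem add_two_pow_succ_le (n : ℕ) (hn : 0 < n) :
    ((n : ℝ) + 2) ^ (n + 1) ≤ 10 * (n : ℝ) ^ (n + 1) := by
  rcases lt_or_ge n 6 with h | h
  · interval_cases n <;> norm_num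
  have hn0 : (0 : ℝ) < n := by exact_mod_cast hn
  have h6 : (6 : ℝ) ≤ n := by exact_mod_cast h
  have h1 : (2 : ℝ) / n + 1 ≤ 4 / 3 := by
    have : (2 : ℝ) / n ≤ 1 / 3 := by rw [div_le_div_iff₀ hn0 (by norm_num)]; linarith
    linarith
  have h2 : ((2 : ℝ) / n + 1) ^ n ≤ Real.exp 1 ^ 2 := by
    calc ((2 : ℝ) / n + 1) ^ n ≤ Real.exp (2 / n) ^ n := by
          gcongr
          exact Real.add_one_le_exp _
      _ = Real.exp 1 ^ 2 := by
          rw [← Real.exp_nat_mul, ← Real.exp_nat_mul]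
          congr 1
          field_simp
          norm_num
  have h3 : Real.exp 1 ^ 2 ≤ 7.5 := by
    have := Real.exp_one_lt_d9
    have := Real.exp_pos 1
    nlinarith
  have h4 : ((2 : ℝ) / n + 1) ^ (n + 1) ≤ 10 := by
    rw [pow_succ]
    calc _ ≤ (7.5 : ℝ) * (4 / 3) := by
          gcongr
          exact h2.trans h3
      _ = 10 := by norm_num
  calc ((n : ℝ) + 2) ^ (n + 1) = ((2 : ℝ) / n + 1) ^ (n + 1) * (n : ℝ) ^ (n + 1) := by
        rw [← mul_pow]
        congr 1
        field_simp
        ring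
    _ ≤ _ := by gcongr

theorem pi_mul_add_two_rpow_le (n : ℕ) (hn : 0 < n) :
    Real.pi * ((n : ℝ) + 2) ^ (((n : ℝ) + 1) / 2) ≤ 10 * (n : ℝ) ^ (((n : ℝ) + 1) / 2) := by
  have sq (x : ℝ) (hx : 0 ≤ x) : (x ^ (((n : ℝ) + 1) / 2)) ^ 2 = x ^ (n + 1) := by
    rw [← Real.rpow_natCast, ← Real.rpow_mul hx, ← Real.rpow_natCast]
    congr 1
    push_cast
    ring
  have hpi : Real.pi ^ 2 ≤ 10 := by
    have := Real.pi_lt_d2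
    have := Real.pi_pos
    nlinarith
  refine le_of_sq_le_sq ?_ (by positivity)
  rw [mul_pow, mul_pow, sq _ (by positivity), sq _ (by positivity)]
  calc Real.pi ^ 2 * ((n : ℝ) + 2) ^ (n + 1) ≤ 10 * (10 * (n : ℝ) ^ (n + 1)) := by
        gcongr
        exact add_two_pow_succ_le n hn
    _ = _ := by ring

theorem sqrt_pi_pow_div_Gamma_mul_rpow_le (n : ℕ) (hn : 0 < n) :
    √Real.pi ^ n / Real.Gamma ((n : ℝ) / 2 + 1) * (n : ℝ) ^ (((n : ℝ) + 1) / 2) ≤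
      2 * 20 ^ ((n : ℝ) / 2) := by
  induction n using Nat.twoStepInduction with
  | zero => exact absurd hn (lt_irrefl 0)
  | one =>
    have hpi : √Real.pi ≠ 0 := by positivity
    have h20 : (1 : ℝ) ≤ 20 ^ ((1 : ℝ) / 2) := Real.one_le_rpow (by norm_num) (by norm_num)
    rw [Nat.cast_one, Real.Gamma_add_one (by norm_num), Real.Gamma_one_half_eq, Real.one_rpow]
    field_simp
    linarith
  | more n ih _ =>
    rcases Nat.eq_zero_or_pos n with rfl | hpos
    · have h2 : (2 : ℝ) ^ ((3 : ℝ) / 2) ≤ 2 ^ (2 : ℝ) :=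
        Real.rpow_le_rpow_of_exponent_le (by norm_num) (by norm_num)
      have hpi := Real.pi_lt_d2
      have hp : (0 : ℝ) < 2 ^ ((3 : ℝ) / 2) := by positivity
      norm_num [Real.Gamma_two, Real.sq_sqrt Real.pi_pos.le] at h2 ⊢
      nlinarith [Real.pi_pos]
    have hn0 : (0 : ℝ) < n := by exact_mod_cast hpos
    have hG : 0 < Real.Gamma ((n : ℝ) / 2 + 1) := Real.Gamma_pos_of_pos (by positivity)
    have e1 : Real.Gamma (((n + 2 : ℕ) : ℝ) / 2 + 1) =
        ((n : ℝ) / 2 + 1) * Real.Gamma ((n : ℝ) / 2 + 1) := by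
      rw [← Real.Gamma_add_one (by positivity)]
      congr 1
      push_cast
      ring
    have e2 : ((n + 2 : ℕ) : ℝ) ^ ((((n + 2 : ℕ) : ℝ) + 1) / 2) =
        ((n : ℝ) + 2) ^ (((n : ℝ) + 1) / 2) * ((n : ℝ) + 2) := by
      rw [← Real.rpow_add_one (by positivity)]
      push_cast
      congr 1
      ring
    have e3 : (20 : ℝ) ^ (((n + 2 : ℕ) : ℝ) / 2) = 20 ^ ((n : ℝ) / 2) * 20 := by
      rw [← Real.rpow_add_one (by norm_num)]
      congr 1
      push_cast
      ring
    rw [e1, e2, e3, pow_add, Real.sq_sqrt Real.pi_pos.le]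
    calc _ = 2 * (√Real.pi ^ n / Real.Gamma ((n : ℝ) / 2 + 1)) *
          (Real.pi * ((n : ℝ) + 2) ^ (((n : ℝ) + 1) / 2)) := by
          field_simp
      _ ≤ 2 * (√Real.pi ^ n / Real.Gamma ((n : ℝ) / 2 + 1)) *
          (10 * (n : ℝ) ^ (((n : ℝ) + 1) / 2)) := by
          exact mul_le_mul_of_nonneg_left (pi_mul_add_two_rpow_le n hpos) (by positivity)
      _ ≤ _ := by linarith [ih hpos]

/-- For every positive integer `N`, the volume `Ω_N` of the closed unit ball in `ℝ^N`
satisfies `0 ≤ Ω_N ≤ 2 · 20^(N/2) / N^((N+1)/2)`. -/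
theorem volume_unit_ball_le (N : ℕ) (hN : 0 < N) :
    0 ≤ volume (Metric.closedBall (0 : EuclideanSpace ℝ (Fin N)) 1) ∧
    volume (Metric.closedBall (0 : EuclideanSpace ℝ (Fin N)) 1) ≤
      ENNReal.ofReal (2 * 20 ^ ((N : ℝ) / 2) / (N : ℝ) ^ (((N : ℝ) + 1) / 2)) := by
  refine ⟨zero_le, ?_⟩
  have : Nonempty (Fin N) := ⟨⟨0, hN⟩⟩
  have hN0 : (0 : ℝ) < N := by exact_mod_cast hN
  rw [EuclideanSpace.volume_closedBall, ENNReal.ofReal_one, one_pow, one_mul, Fintype.card_fin]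
  apply ENNReal.ofReal_le_ofReal
  rw [le_div_iff₀ (by positivity)]
  exact sqrt_pi_pow_div_Gamma_mul_rpow_le N hN
end

section
/- Define R_N = (N + 1 − 2√N)^(N/2) · Ω_N / 2^N, where Ω_N is the volume of the unit ball in ℝ^N; equivalently R_N = (√N − 1)^N · Ω_N / 2^N. Then R_N → +∞ as N → +∞. -/
open MeasureTheory Filter

namespace Real

/-- A crude Stirling-type upper bound for the Gamma function at half-integers. -/
theorem Gamma_nat_div_two_add_one_le (n : ℕ) :
    Gamma ((n : ℝ) / 2 + 1) ≤ 2 * √((n : ℝ) / 2) ^ n := by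
  induction n using Nat.twoStepInduction with
  | zero => simp
  | one =>
    have h1 : Gamma (((1 : ℕ) : ℝ) / 2 + 1) = 1 / 2 * √π := by
      rw [Nat.cast_one, Gamma_add_one (by norm_num), Gamma_one_half_eq]
    have h2 : √π ≤ 2 := sqrt_le_iff.2 ⟨by norm_num, by linarith [pi_le_four]⟩
    have h3 : 1 / 2 ≤ √(((1 : ℕ) : ℝ) / 2) := le_sqrt_of_sq_le (by norm_num)
    rw [h1, pow_one]
    linarith
  | more n ih _ =>
    have h0 : (((n + 2 : ℕ) : ℝ)) / 2 = (n : ℝ) / 2 + 1 := by push_cast; ring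
    have hpos : (0 : ℝ) < (n : ℝ) / 2 + 1 := by positivity
    rw [h0, Gamma_add_one hpos.ne', pow_add, sq_sqrt hpos.le]
    calc ((n : ℝ) / 2 + 1) * Gamma ((n : ℝ) / 2 + 1)
        ≤ ((n : ℝ) / 2 + 1) * (2 * √((n : ℝ) / 2) ^ n) := by gcongr
      _ ≤ ((n : ℝ) / 2 + 1) * (2 * √((n : ℝ) / 2 + 1) ^ n) := by
          gcongr
          linarith
      _ = 2 * (√((n : ℝ) / 2 + 1) ^ n * ((n : ℝ) / 2 + 1)) := by ring

end Real

/-- A lower bound for the volume of the unit ball in `ℝ^n`. -/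
theorem EuclideanSpace.le_volume_unit_closedBall {n : ℕ} (hn : n ≠ 0) :
    (√Real.pi / √((n : ℝ) / 2)) ^ n / 2 ≤
      (volume (Metric.closedBall (0 : EuclideanSpace ℝ (Fin n)) 1)).toReal := by
  have : Nonempty (Fin n) := ⟨⟨0, Nat.pos_of_ne_zero hn⟩⟩
  have hG : 0 < Real.Gamma ((n : ℝ) / 2 + 1) := Real.Gamma_pos_of_pos (by positivity)
  rw [EuclideanSpace.volume_closedBall, Fintype.card_fin, ENNReal.ofReal_one, one_pow, one_mul,
    ENNReal.toReal_ofReal (by positivity), div_pow, div_div, mul_comm (_ ^ n) (2 : ℝ)]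
  gcongr
  exact Real.Gamma_nat_div_two_add_one_le n

/-- The base of the geometric lower bound for the leakage ratio is bounded away from `1`. -/
theorem leakage_base_lower_bound {x : ℝ} (hx : 100 ≤ x) :
    11 / 10 ≤ (√x - 1) * (√Real.pi / √(x / 2)) / 2 := by
  have h1 : 10 ≤ √x := Real.le_sqrt_of_sq_le (by linarith)
  have h2 : 177 / 100 ≤ √Real.pi :=
    Real.le_sqrt_of_sq_le (by linarith [Real.pi_gt_d2])
  have h3 : √(x / 2) ≤ 708 / 1000 * √x := by
    refine Real.sqrt_le_iff.2 ⟨by positivity, ?_⟩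
    rw [mul_pow, Real.sq_sqrt (by linarith)]
    linarith
  have h4 : 0 < √(x / 2) := Real.sqrt_pos.2 (by linarith)
  rw [← mul_div_assoc, div_div, le_div_iff₀ (by positivity)]
  nlinarith [mul_le_mul_of_nonneg_left h2 (show 0 ≤ √x - 1 by linarith)]

/-- With `Ω_N` the volume of the closed unit ball in `ℝ^N`, the ratio
`R_N = (√N - 1)^N · Ω_N / 2^N` (the volume of the inner shaded ball divided by the volume
of the box of side 2) tends to `+∞` as `N → +∞`. -/
theorem leakage_ratio_tendsto_atTop :
    Tendsto
      (fun N : ℕ =>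
        (Real.sqrt N - 1) ^ N *
            (volume (Metric.closedBall (0 : EuclideanSpace ℝ (Fin N)) 1)).toReal / 2 ^ N)
      atTop atTop := by
  have hpow : Tendsto (fun N : ℕ => (11 / 10 : ℝ) ^ N / 2) atTop atTop :=
    (tendsto_pow_atTop_atTop_of_one_lt (by norm_num)).atTop_div_const (by norm_num)
  refine tendsto_atTop_mono' atTop ?_ hpow
  filter_upwards [eventually_ge_atTop 100] with N hN
  have hN' : (100 : ℝ) ≤ N := by exact_mod_cast hN
  have hs : 0 ≤ √(N : ℝ) - 1 := by
    linarith [Real.le_sqrt_of_sq_le (show (1 : ℝ) ^ 2 ≤ N by linarith)]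
  calc (11 / 10 : ℝ) ^ N / 2
      ≤ ((√(N : ℝ) - 1) * (√Real.pi / √((N : ℝ) / 2)) / 2) ^ N / 2 := by
        gcongr ?_ ^ N / 2
        exact leakage_base_lower_bound hN'
    _ = (√(N : ℝ) - 1) ^ N * ((√Real.pi / √((N : ℝ) / 2)) ^ N / 2) / 2 ^ N := by
        rw [div_pow, mul_pow]
        ring
    _ ≤ _ := by
        gcongr
        exact EuclideanSpace.le_volume_unit_closedBall (by lia)
end

section
/- Let N ≥ 2 and 0 ≤ k ≤ N. The centroid C_{k,N} of the k-skeleton S_k of the standard simplex in ℝ^N equals (1/N) · (k + (N − k)·√(k+1)) / ((k+1) + (N − k)·√(k+1)) · (e_1 + e_2 + ⋯ + e_N), where e_j is the j-th standard basis vector. -/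
open MeasureTheory

/-- The vertices of the standard simplex in `ℝ^N`: the origin together with the standard
basis vectors `e_1, …, e_N`. -/
noncomputable def simplexVertex (N : ℕ) (i : Fin (N + 1)) : EuclideanSpace ℝ (Fin N) :=
  if h : i = 0 then 0 else EuclideanSpace.single (i.pred h) 1

/-- The `k`-skeleton of the standard simplex in `ℝ^N`: the union of the convex hulls of
all `(k+1)`-element subsets of the vertex set `{0, e_1, …, e_N}`. -/
def simplexSkeleton (N k : ℕ) : Set (EuclideanSpace ℝ (Fin N)) :=
  ⋃ s ∈ {s : Finset (Fin (N + 1)) | s.card = k + 1}, convexHull ℝ (simplexVertex N '' ↑s)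

/-- The centroid `C_{k,N}` of the `k`-skeleton of the standard simplex in `ℝ^N`: the
vector-valued integral of the identity over the skeleton with respect to `k`-dimensional
Hausdorff measure, divided by the total `k`-dimensional Hausdorff measure of the
skeleton. -/
noncomputable def skeletonCentroid (N k : ℕ) : EuclideanSpace ℝ (Fin N) :=
  (μH[(k : ℝ)] (simplexSkeleton N k)).toReal⁻¹ •
    ∫ x in simplexSkeleton N k, x ∂(μH[(k : ℝ)])

theorem hausdorffMeasure_isAddHaar (k : ℕ) :
    (μH[(k : ℝ)] : Measure (EuclideanSpace ℝ (Fin k))).IsAddHaarMeasure := by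
  simpa using isAddHaarMeasure_hausdorffMeasure (E := EuclideanSpace ℝ (Fin k))

/-- Area formula for an injective affine map, with the Jacobian factored through an endomorphism
`A` of the source having the same metric distortion. -/
theorem hausdorffMeasure_restrict_affine_image {k N : ℕ}
    (φ : EuclideanSpace ℝ (Fin k) →ᵃ[ℝ] EuclideanSpace ℝ (Fin N))
    (A : EuclideanSpace ℝ (Fin k) →ₗ[ℝ] EuclideanSpace ℝ (Fin k)) (hA : LinearMap.det A ≠ 0)
    (h : ∀ x, ‖φ.linear x‖ = ‖A x‖) {T : Set (EuclideanSpace ℝ (Fin k))} (hT : IsCompact T) :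
    (μH[(k : ℝ)] : Measure (EuclideanSpace ℝ (Fin N))).restrict (φ '' T) =
      ENNReal.ofReal |LinearMap.det A| • ((μH[(k : ℝ)]).restrict T).map φ := by
  have := hausdorffMeasure_isAddHaar k
  let e := LinearMap.equivOfDetNeZero A hA
  have he : ∀ x, e x = A x := fun x => rfl
  let J : EuclideanSpace ℝ (Fin k) → EuclideanSpace ℝ (Fin N) := fun y => φ (e.symm y)
  have hJ : Isometry J := by
    refine Isometry.of_dist_eq fun y z => ?_
    rw [dist_eq_norm, dist_eq_norm, ← vsub_eq_sub (J y), ← AffineMap.linearMap_vsub, h, ← he,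
      vsub_eq_sub, map_sub]
    simp
  have hφ : (φ : EuclideanSpace ℝ (Fin k) → EuclideanSpace ℝ (Fin N)) = J ∘ A := by
    ext1 x
    simp [J, ← he]
  have hφc : Continuous φ := φ.continuous_of_finiteDimensional
  have hφi : Function.Injective φ := by
    rw [hφ]
    exact hJ.injective.comp e.injective
  have hmap : (μH[(k : ℝ)]).map φ = ENNReal.ofReal |(LinearMap.det A)⁻¹| •
      (μH[(k : ℝ)] : Measure (EuclideanSpace ℝ (Fin N))).restrict (Set.range J) := by
    rw [hφ, ← Measure.map_map hJ.continuous.measurable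
      A.continuous_of_finiteDimensional.measurable,
      Measure.map_linearMap_addHaar_eq_smul_addHaar _ hA, Measure.map_smul,
      hJ.map_hausdorffMeasure (Or.inl (by positivity))]
  have hm : MeasurableSet (φ '' T) := (hT.image hφc).measurableSet
  have hsub : φ '' T ⊆ Set.range J := by
    rw [hφ, Set.image_comp]
    exact Set.image_subset_range _ _
  have hr := congrArg (fun m => m.restrict (φ '' T)) hmap
  simp only [Measure.restrict_smul] at hr
  rw [Measure.restrict_restrict_of_subset hsub, Measure.restrict_map hφc.measurable hm,
    Set.preimage_image_eq _ hφi] at hr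
  rw [hr, smul_smul, ← ENNReal.ofReal_mul (abs_nonneg _), ← abs_mul, mul_inv_cancel₀ hA]
  simp

theorem simplexVertex_apply (N : ℕ) (m : Fin (N + 1)) (i : Fin N) :
    simplexVertex N m i = if m = i.succ then 1 else 0 := by
  induction m using Fin.cases with
  | zero => simp [simplexVertex, (Fin.succ_ne_zero i).symm]
  | succ j => simp [simplexVertex, eq_comm]

theorem simplexVertex_zero (N : ℕ) : simplexVertex N 0 = 0 := by simp [simplexVertex]

theorem simplexVertex_succ (N : ℕ) (i : Fin N) :
    simplexVertex N i.succ = EuclideanSpace.single i 1 := by simp [simplexVertex]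

theorem affineIndependent_simplexVertex (N : ℕ) : AffineIndependent ℝ (simplexVertex N) := by
  rw [affineIndependent_iff_linearIndependent_vsub ℝ _ 0]
  have h := (EuclideanSpace.orthonormal_single (𝕜 := ℝ) (ι := Fin N)).linearIndependent.comp
    (fun i : {x : Fin (N + 1) // x ≠ 0} => i.1.pred i.2)
    (fun a b hab => Subtype.ext (Fin.pred_inj.1 hab))
  have he : (fun i : {x : Fin (N + 1) // x ≠ 0} => simplexVertex N i -ᵥ simplexVertex N 0) =
      (fun i : Fin N => EuclideanSpace.single i (1 : ℝ)) ∘ fun i => i.1.pred i.2 := by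
    ext1 i
    simp [simplexVertex, i.2]
  rw [he]
  exact h

theorem affineSpan_range_simplexVertex (N : ℕ) :
    affineSpan ℝ (Set.range (simplexVertex N)) = ⊤ := by
  rw [(affineIndependent_simplexVertex N).affineSpan_eq_top_iff_card_eq_finrank_add_one]
  simp

theorem isCompact_convexHull_range_simplexVertex (k : ℕ) :
    IsCompact (convexHull ℝ (Set.range (simplexVertex k))) :=
  (Set.finite_range _).isCompact_convexHull ℝ

theorem hausdorffMeasure_simplex_pos (k : ℕ) :
    0 < (μH[(k : ℝ)]).real (convexHull ℝ (Set.range (simplexVertex k))) := by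
  have := hausdorffMeasure_isAddHaar k
  refine ENNReal.toReal_pos ?_ (isCompact_convexHull_range_simplexVertex k).measure_lt_top.ne
  refine (Measure.measure_pos_of_nonempty_interior _ ?_).ne'
  rw [(convex_convexHull ℝ _).interior_nonempty_iff_affineSpan_eq_top, affineSpan_convexHull,
    affineSpan_range_simplexVertex]

/-- Barycentric coordinates with respect to the vertices of the standard simplex. -/
noncomputable def simplexCoord {k : ℕ} (x : EuclideanSpace ℝ (Fin k)) : Fin (k + 1) → ℝ :=
  Fin.cons (1 - ∑ i, x i) fun i => x i

theorem sum_simplexCoord {k : ℕ} (x : EuclideanSpace ℝ (Fin k)) : ∑ i, simplexCoord x i = 1 := by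
  simp [simplexCoord, Fin.sum_univ_succ]

theorem continuous_simplexCoord {k : ℕ} (i : Fin (k + 1)) :
    Continuous fun x : EuclideanSpace ℝ (Fin k) => simplexCoord x i := by
  induction i using Fin.cases with
  | zero => simp only [simplexCoord, Fin.cons_zero]; fun_prop
  | succ j => simp only [simplexCoord, Fin.cons_succ]; fun_prop

/-- The affine map sending the `i`-th vertex of the standard `k`-simplex to the `f i`-th vertex
of the standard `N`-simplex. -/
noncomputable def simplexMap {k N : ℕ} (f : Fin (k + 1) → Fin (N + 1)) :
    EuclideanSpace ℝ (Fin k) →ᵃ[ℝ] EuclideanSpace ℝ (Fin N) :=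
  (∑ i : Fin k, (EuclideanSpace.proj (𝕜 := ℝ) i).toLinearMap.smulRight
    (simplexVertex N (f i.succ) - simplexVertex N (f 0))).toAffineMap +
    AffineMap.const ℝ _ (simplexVertex N (f 0))

theorem simplexMap_linear {k N : ℕ} (f : Fin (k + 1) → Fin (N + 1))
    (x : EuclideanSpace ℝ (Fin k)) : (simplexMap f).linear x =
      ∑ i : Fin k, x i • (simplexVertex N (f i.succ) - simplexVertex N (f 0)) := by
  simp [simplexMap]

theorem simplexMap_apply {k N : ℕ} (f : Fin (k + 1) → Fin (N + 1))
    (x : EuclideanSpace ℝ (Fin k)) :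
    simplexMap f x = ∑ i, simplexCoord x i • simplexVertex N (f i) := by
  simp only [simplexMap, simplexCoord, Fin.sum_univ_succ, Fin.cons_zero, Fin.cons_succ, smul_sub,
    sub_smul, Finset.sum_smul, AffineMap.coe_add, Pi.add_apply, LinearMap.coe_toAffineMap,
    AffineMap.const_apply, LinearMap.sum_apply, LinearMap.smulRight_apply, Finset.sum_sub_distrib]
  simp
  abel

theorem simplexCoord_simplexVertex {k : ℕ} (m i : Fin (k + 1)) :
    simplexCoord (simplexVertex k m) i = if m = i then 1 else 0 := by
  induction i using Fin.cases with
  | zero =>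
    induction m using Fin.cases with
    | zero => simp [simplexCoord, simplexVertex_zero]
    | succ j => simp [simplexCoord, simplexVertex_apply]
  | succ j => simp [simplexCoord, simplexVertex_apply]

theorem simplexMap_vertex {k N : ℕ} (f : Fin (k + 1) → Fin (N + 1)) (i : Fin (k + 1)) :
    simplexMap f (simplexVertex k i) = simplexVertex N (f i) := by
  simp [simplexMap_apply, simplexCoord_simplexVertex]

theorem simplexMap_image {k N : ℕ} (f : Fin (k + 1) → Fin (N + 1)) :
    simplexMap f '' convexHull ℝ (Set.range (simplexVertex k)) =
      convexHull ℝ (simplexVertex N '' Set.range f) := by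
  rw [AffineMap.image_convexHull, ← Set.range_comp, ← Set.range_comp]
  congr 2
  ext1 i
  exact simplexMap_vertex f i

theorem simplexCoord_simplexMap_perm {k : ℕ} (σ : Equiv.Perm (Fin (k + 1)))
    (x : EuclideanSpace ℝ (Fin k)) (i : Fin (k + 1)) :
    simplexCoord (simplexMap σ x) (σ i) = simplexCoord x i := by
  have hs : ∀ j : Fin (k + 1), j ≠ 0 →
      simplexCoord (simplexMap σ x) j = simplexCoord x (σ.symm j) := by
    intro j hj
    obtain ⟨j, rfl⟩ := Fin.exists_succ_eq.2 hj
    rw [simplexCoord, Fin.cons_succ, simplexMap_apply]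
    simp [simplexVertex_apply, ← Equiv.eq_symm_apply]
  by_cases h0 : σ i = 0
  · have h1 := sum_simplexCoord (simplexMap σ x)
    have h2 := sum_simplexCoord x
    rw [← Equiv.sum_comp σ, ← Finset.add_sum_erase _ _ (Finset.mem_univ i)] at h1
    rw [← Finset.add_sum_erase _ _ (Finset.mem_univ i)] at h2
    have h3 : ∑ j ∈ Finset.univ.erase i, simplexCoord (simplexMap σ x) (σ j) =
        ∑ j ∈ Finset.univ.erase i, simplexCoord x j := by
      refine Finset.sum_congr rfl fun j hj => ?_
      rw [hs _ fun h => Finset.ne_of_mem_erase hj (σ.injective (h.trans h0.symm)),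
        Equiv.symm_apply_apply]
    linarith
  · rw [hs _ h0, Equiv.symm_apply_apply]

theorem integral_simplexCoord {k : ℕ} (i : Fin (k + 1)) :
    ∫ x in convexHull ℝ (Set.range (simplexVertex k)), simplexCoord x i ∂μH[(k : ℝ)] =
      (μH[(k : ℝ)]).real (convexHull ℝ (Set.range (simplexVertex k))) / (k + 1) := by
  have := hausdorffMeasure_isAddHaar k
  set T := convexHull ℝ (Set.range (simplexVertex k)) with hT
  have hTc : IsCompact T := isCompact_convexHull_range_simplexVertex k
  have hpos := hausdorffMeasure_simplex_pos k
  rw [← hT] at hpos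
  have key : ∀ i : Fin (k + 1), ∫ x in T, simplexCoord x i ∂μH[(k : ℝ)] =
      ∫ x in T, simplexCoord x 0 ∂μH[(k : ℝ)] := by
    intro i
    let σ := Equiv.swap 0 i
    have hsurj : Function.Surjective (simplexMap σ) := by
      intro y
      refine ⟨simplexMap σ y, ?_⟩
      have hc : ∀ j, simplexCoord (simplexMap σ (simplexMap σ y)) j = simplexCoord y j := by
        intro j
        obtain ⟨j, rfl⟩ := σ.surjective j
        rw [simplexCoord_simplexMap_perm]
        obtain ⟨j, rfl⟩ := σ.surjective j
        rw [simplexCoord_simplexMap_perm]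
        simp [σ]
      ext j
      simpa [simplexCoord] using hc j.succ
    have hdet : LinearMap.det (simplexMap σ).linear ≠ 0 := by
      have hls := (AffineMap.linear_surjective_iff _).2 hsurj
      have hli := LinearMap.injective_iff_surjective.2 hls
      exact (LinearEquiv.isUnit_det' (LinearEquiv.ofBijective _ ⟨hli, hls⟩)).ne_zero
    have him : simplexMap σ '' T = T := by
      rw [hT, simplexMap_image, σ.surjective.range_eq, Set.image_univ]
    have hr := hausdorffMeasure_restrict_affine_image (simplexMap σ) _ hdet (fun _ => rfl) hTc
    rw [him] at hr
    have hφc : Continuous (simplexMap σ) := (simplexMap σ).continuous_of_finiteDimensional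
    have hmass := congrArg (fun m => m.real Set.univ) hr
    simp only [measureReal_ennreal_smul_apply, map_measureReal_apply hφc.measurable .univ,
      Set.preimage_univ, measureReal_restrict_apply_univ] at hmass
    have hone : (ENNReal.ofReal |LinearMap.det (simplexMap σ).linear|).toReal = 1 := by
      nlinarith
    calc ∫ x in T, simplexCoord x i ∂μH[(k : ℝ)]
        = ∫ x in T, simplexCoord (simplexMap σ x) i ∂μH[(k : ℝ)] := by
          conv_lhs => rw [hr]
          rw [integral_smul_measure, hone, one_smul, integral_map hφc.aemeasurable
            (continuous_simplexCoord i).aestronglyMeasurable]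
      _ = _ := by
          refine integral_congr_ae (Filter.Eventually.of_forall fun x => ?_)
          have := simplexCoord_simplexMap_perm σ x 0
          simpa [σ] using this
  have hsum : ∑ i : Fin (k + 1), ∫ x in T, simplexCoord x i ∂μH[(k : ℝ)] =
      (μH[(k : ℝ)]).real T := by
    rw [← integral_finsetSum _ fun i _ =>
      ((continuous_simplexCoord i).continuousOn.integrableOn_compact hTc)]
    simp [sum_simplexCoord]
  rw [Finset.sum_congr rfl fun i _ => key i] at hsum
  rw [key i, ← hsum]
  simp
  field_simp

theorem norm_sq_sum_smul_single {ι : Type*} [Fintype ι] {N : ℕ} {g : ι → Fin N}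
    (hg : Function.Injective g) (c : ι → ℝ) :
    ‖∑ i, c i • EuclideanSpace.single (g i) (1 : ℝ)‖ ^ 2 = ∑ i, c i ^ 2 := by
  have h := ((EuclideanSpace.orthonormal_single (𝕜 := ℝ) (ι := Fin N)).comp g hg).inner_sum
    c c Finset.univ
  rw [← real_inner_self_eq_norm_sq]
  simp only [Function.comp_apply] at h
  rw [h]
  simp [sq]

/-- The positive square root of the Gram operator `x ↦ x + (∑ i, x i) • (1, …, 1)` of the facet
opposite to the origin. -/
noncomputable def facetStretch (k : ℕ) :
    EuclideanSpace ℝ (Fin k) →ₗ[ℝ] EuclideanSpace ℝ (Fin k) :=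
  LinearMap.transvection (∑ i, (EuclideanSpace.proj (𝕜 := ℝ) i).toLinearMap)
    (WithLp.toLp 2 fun _ => (Real.sqrt (k + 1) - 1) / k)

theorem facetStretch_apply {k : ℕ} (x : EuclideanSpace ℝ (Fin k)) (i : Fin k) :
    facetStretch k x i = x i + (∑ j, x j) * ((Real.sqrt (k + 1) - 1) / k) := by
  simp [facetStretch, LinearMap.transvection.apply]

theorem det_facetStretch (k : ℕ) : LinearMap.det (facetStretch k) = Real.sqrt (k + 1) := by
  rw [facetStretch, LinearMap.transvection.det]
  rcases Nat.eq_zero_or_pos k with rfl | hk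
  · simp
  · have : (k : ℝ) ≠ 0 := by positivity
    simp
    field_simp
    ring

theorem norm_sq_facetStretch {k : ℕ} (x : EuclideanSpace ℝ (Fin k)) :
    ‖facetStretch k x‖ ^ 2 = (∑ i, x i) ^ 2 + ∑ i, x i ^ 2 := by
  simp only [EuclideanSpace.norm_sq_eq, facetStretch_apply, Real.norm_eq_abs, sq_abs, add_sq,
    Finset.sum_add_distrib, Finset.sum_const, Finset.card_univ, Fintype.card_fin, nsmul_eq_mul]
  rcases Nat.eq_zero_or_pos k with rfl | hk
  · simp
  · have : (k : ℝ) ≠ 0 := by positivity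
    rw [← Finset.sum_mul, ← Finset.mul_sum]
    have hs : Real.sqrt (k + 1) ^ 2 = k + 1 := Real.sq_sqrt (by positivity)
    field_simp
    linear_combination (∑ i, x i) ^ 2 * hs

theorem norm_simplexMap_linear_of_zero {k N : ℕ} {f : Fin (k + 1) → Fin (N + 1)}
    (hf : Function.Injective f) (h0 : f 0 = 0) (x : EuclideanSpace ℝ (Fin k)) :
    ‖(simplexMap f).linear x‖ = ‖x‖ := by
  have hne : ∀ i : Fin k, f i.succ ≠ 0 := fun i h =>
    Fin.succ_ne_zero i (hf (h.trans h0.symm))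
  have hg : Function.Injective fun i : Fin k => (f i.succ).pred (hne i) := fun i j h =>
    Fin.succ_injective _ (hf (Fin.pred_inj.1 h))
  rw [← sq_eq_sq₀ (norm_nonneg _) (norm_nonneg _), simplexMap_linear]
  have : ∀ i : Fin k, simplexVertex N (f i.succ) - simplexVertex N (f 0) =
      EuclideanSpace.single ((f i.succ).pred (hne i)) (1 : ℝ) := by
    intro i
    simp [simplexVertex, h0, hne]
  simp only [this]
  rw [norm_sq_sum_smul_single hg, EuclideanSpace.norm_sq_eq]
  simp

theorem norm_simplexMap_linear_of_ne_zero {k N : ℕ} {f : Fin (k + 1) → Fin (N + 1)}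
    (hf : Function.Injective f) (hne : ∀ i, f i ≠ 0) (x : EuclideanSpace ℝ (Fin k)) :
    ‖(simplexMap f).linear x‖ = ‖facetStretch k x‖ := by
  have hg : Function.Injective fun i => (f i).pred (hne i) := fun i j h =>
    hf (Fin.pred_inj.1 h)
  rw [← sq_eq_sq₀ (norm_nonneg _) (norm_nonneg _), norm_sq_facetStretch]
  have h := norm_sq_sum_smul_single hg (Fin.cons (-∑ i, x i) fun i => x i)
  rw [Fin.sum_univ_succ, Fin.sum_univ_succ] at h
  simp only [Fin.cons_zero, Fin.cons_succ, neg_sq] at h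
  rw [← h, simplexMap_linear]
  congr 2
  simp [simplexVertex, hne, smul_sub, Finset.sum_smul, ← sub_eq_neg_add]

/-- The ratio of the volume of a `k`-dimensional face of the standard simplex to that of the
standard `k`-simplex. -/
noncomputable def faceWeight {N : ℕ} (k : ℕ) (s : Finset (Fin (N + 1))) : ℝ :=
  if 0 ∈ s then 1 else Real.sqrt (k + 1)

theorem faceWeight_nonneg {N : ℕ} (k : ℕ) (s : Finset (Fin (N + 1))) : 0 ≤ faceWeight k s := by
  unfold faceWeight
  split_ifs <;> positivity

theorem hausdorffMeasure_restrict_face {N k : ℕ} {s : Finset (Fin (N + 1))}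
    (hs : s.card = k + 1) :
    (μH[(k : ℝ)] : Measure (EuclideanSpace ℝ (Fin N))).restrict
        (convexHull ℝ (simplexVertex N '' ↑s)) =
      ENNReal.ofReal (faceWeight k s) •
        ((μH[(k : ℝ)]).restrict (convexHull ℝ (Set.range (simplexVertex k)))).map
          (simplexMap (s.orderEmbOfFin hs)) := by
  set f := s.orderEmbOfFin hs with hf
  have hT := isCompact_convexHull_range_simplexVertex k
  have hr : Set.range f = ↑s := Finset.range_orderEmbOfFin s hs
  rw [← hr, ← simplexMap_image]
  by_cases h0 : (0 : Fin (N + 1)) ∈ s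
  · have hf0 : f 0 = 0 := by
      obtain ⟨i, hi⟩ : (0 : Fin (N + 1)) ∈ Set.range f := by rw [hr]; exact h0
      exact le_antisymm (hi ▸ f.monotone (Fin.zero_le i)) (Fin.zero_le _)
    have := hausdorffMeasure_restrict_affine_image (simplexMap f) LinearMap.id (by simp)
      (norm_simplexMap_linear_of_zero f.injective hf0) hT
    simpa [faceWeight, h0] using this
  · have hne : ∀ i, f i ≠ 0 := fun i h => h0 (h ▸ Finset.orderEmbOfFin_mem s hs i)
    have hpos : 0 < Real.sqrt ((k : ℝ) + 1) := by positivity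
    have := hausdorffMeasure_restrict_affine_image (simplexMap f) (facetStretch k)
      (by rw [det_facetStretch]; exact hpos.ne')
      (norm_simplexMap_linear_of_ne_zero f.injective hne) hT
    rw [det_facetStretch, abs_of_pos hpos] at this
    simpa only [faceWeight, h0, if_false] using this

theorem hausdorffMeasure_face_eq_zero {N k : ℕ} {s : Finset (Fin (N + 1))}
    (hs : s.card < k + 1) :
    (μH[(k : ℝ)] : Measure (EuclideanSpace ℝ (Fin N))) (convexHull ℝ (simplexVertex N '' ↑s)) =
      0 := by
  rcases s.eq_empty_or_nonempty with rfl | hne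
  · simp
  obtain ⟨m, hm⟩ := Nat.exists_eq_succ_of_ne_zero hne.card_pos.ne'
  have hmk : m < k := by omega
  rw [← Finset.range_orderEmbOfFin s hm, ← simplexMap_image]
  set φ := simplexMap (s.orderEmbOfFin hm)
  have hd : dimH (φ '' convexHull ℝ (Set.range (simplexVertex m))) < ((k : NNReal) : ENNReal) := by
    let ψ : EuclideanSpace ℝ (Fin m) →ᴬ[ℝ] EuclideanSpace ℝ (Fin N) :=
      ⟨φ, φ.continuous_of_finiteDimensional⟩
    refine ((dimH_mono (Set.image_subset_range _ _)).trans
      (ContDiff.dimH_range_le (f := φ) (ψ.contDiff.of_le le_top))).trans_lt ?_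
    simpa using hmk
  simpa using hausdorffMeasure_of_dimH_lt hd

theorem aedisjoint_faces {N k : ℕ} {s t : Finset (Fin (N + 1))} (hs : s.card = k + 1)
    (ht : t.card = k + 1) (hst : s ≠ t) :
    AEDisjoint (μH[(k : ℝ)] : Measure (EuclideanSpace ℝ (Fin N)))
      (convexHull ℝ (simplexVertex N '' ↑s)) (convexHull ℝ (simplexVertex N '' ↑t)) := by
  classical
  have hi := affineIndependent_simplexVertex N
  have hinter := AffineIndependent.convexHull_inter (R := ℝ) (t₁ := s.image (simplexVertex N))
    (t₂ := t.image (simplexVertex N)) (s := Finset.univ.image (simplexVertex N))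
    (hi.range.mono (by simp)) (Finset.image_subset_image (Finset.subset_univ _))
    (Finset.image_subset_image (Finset.subset_univ _))
  rw [AEDisjoint]
  simp only [Finset.coe_image] at hinter
  rw [← hinter, ← Set.image_inter hi.injective, ← Finset.coe_inter]
  refine hausdorffMeasure_face_eq_zero (hs ▸ Finset.card_lt_card ?_)
  refine Finset.inter_subset_left.ssubset_of_ne fun h => hst ?_
  exact Finset.eq_of_subset_of_card_le (Finset.inter_eq_left.1 h) (by omega)

theorem hausdorffMeasure_restrict_skeleton (N k : ℕ) :
    (μH[(k : ℝ)] : Measure (EuclideanSpace ℝ (Fin N))).restrict (simplexSkeleton N k) =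
      Measure.sum fun s : {s : Finset (Fin (N + 1)) // s.card = k + 1} =>
        (μH[(k : ℝ)]).restrict (convexHull ℝ (simplexVertex N '' ↑s.1)) := by
  have : simplexSkeleton N k = ⋃ s : {s : Finset (Fin (N + 1)) // s.card = k + 1},
      convexHull ℝ (simplexVertex N '' ↑s.1) := by
    rw [simplexSkeleton, Set.biUnion_eq_iUnion]
    rfl
  rw [this]
  refine Measure.restrict_iUnion_ae (fun s t hst =>
    aedisjoint_faces s.2 t.2 (Subtype.coe_injective.ne hst)) fun s => ?_
  exact ((s.1.finite_toSet.image _).isCompact_convexHull ℝ).measurableSet.nullMeasurableSet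

theorem hausdorffMeasure_face {N k : ℕ} {s : Finset (Fin (N + 1))} (hs : s.card = k + 1) :
    (μH[(k : ℝ)] : Measure (EuclideanSpace ℝ (Fin N)))
        (convexHull ℝ (simplexVertex N '' ↑s)) =
      ENNReal.ofReal (faceWeight k s) *
        (μH[(k : ℝ)]) (convexHull ℝ (Set.range (simplexVertex k))) := by
  have h := congrArg (fun m => m Set.univ) (hausdorffMeasure_restrict_face hs)
  simpa [Measure.map_apply (simplexMap _).continuous_of_finiteDimensional.measurable] using h

theorem integral_face {N k : ℕ} {s : Finset (Fin (N + 1))} (hs : s.card = k + 1) :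
    ∫ x in convexHull ℝ (simplexVertex N '' ↑s), x ∂μH[(k : ℝ)] =
      (faceWeight k s * ((μH[(k : ℝ)]).real (convexHull ℝ (Set.range (simplexVertex k))) /
        (k + 1))) • ∑ i ∈ s, simplexVertex N i := by
  have := hausdorffMeasure_isAddHaar k
  have hT := isCompact_convexHull_range_simplexVertex k
  have hc := (simplexMap (s.orderEmbOfFin hs)).continuous_of_finiteDimensional
  rw [hausdorffMeasure_restrict_face hs, integral_smul_measure,
    integral_map hc.aemeasurable (by fun_prop), ENNReal.toReal_ofReal (faceWeight_nonneg k s),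
    mul_smul]
  congr 1
  simp only [simplexMap_apply]
  rw [integral_finsetSum _ fun i _ => ContinuousOn.integrableOn_compact hT
    (f := fun x => simplexCoord x i • simplexVertex N (s.orderEmbOfFin hs i))
    ((continuous_simplexCoord i).smul continuous_const).continuousOn]
  simp only [integral_smul_const, integral_simplexCoord]
  rw [← Finset.smul_sum]
  congr 1
  rw [← Finset.sum_image (s := Finset.univ) (g := s.orderEmbOfFin hs)
    (f := fun i => simplexVertex N i) (s.orderEmbOfFin hs).injective.injOn,
    Finset.image_orderEmbOfFin_univ]

theorem integrableOn_id_face {N k : ℕ} {s : Finset (Fin (N + 1))} (hs : s.card = k + 1) :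
    IntegrableOn (fun x => x) (convexHull ℝ (simplexVertex N '' ↑s))
      (μH[(k : ℝ)] : Measure (EuclideanSpace ℝ (Fin N))) := by
  have := hausdorffMeasure_isAddHaar k
  have hc := (simplexMap (s.orderEmbOfFin hs)).continuous_of_finiteDimensional
  rw [IntegrableOn, hausdorffMeasure_restrict_face hs]
  refine Integrable.smul_measure ?_ ENNReal.ofReal_ne_top
  rw [integrable_map_measure (by fun_prop) hc.aemeasurable]
  exact ContinuousOn.integrableOn_compact (isCompact_convexHull_range_simplexVertex k)
    (continuous_id.comp hc).continuousOn

theorem hausdorffMeasure_skeleton (N k : ℕ) :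
    (μH[(k : ℝ)] (simplexSkeleton N k)).toReal =
      (∑ s ∈ Finset.powersetCard (k + 1) (Finset.univ : Finset (Fin (N + 1))), faceWeight k s) *
        (μH[(k : ℝ)]).real (convexHull ℝ (Set.range (simplexVertex k))) := by
  have h := congrArg (fun m => (m Set.univ).toReal) (hausdorffMeasure_restrict_skeleton N k)
  have := hausdorffMeasure_isAddHaar k
  have hfin := (isCompact_convexHull_range_simplexVertex k).measure_lt_top (μ := μH[(k : ℝ)])
  simp only [Measure.restrict_apply_univ, Measure.sum_apply _ MeasurableSet.univ,
    tsum_fintype] at h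
  have hne : ∀ s : {s : Finset (Fin (N + 1)) // s.card = k + 1},
      (μH[(k : ℝ)] : Measure (EuclideanSpace ℝ (Fin N)))
        (convexHull ℝ (simplexVertex N '' ↑s.1)) ≠ ⊤ := fun s => by
    rw [hausdorffMeasure_face s.2]
    exact ENNReal.mul_ne_top ENNReal.ofReal_ne_top hfin.ne
  rw [h, ENNReal.toReal_sum fun s _ => hne s, Finset.sum_mul,
    Finset.sum_subtype (p := fun s : Finset (Fin (N + 1)) => s.card = k + 1) _ (by simp)]
  refine Finset.sum_congr rfl fun s _ => ?_
  rw [hausdorffMeasure_face s.2, ENNReal.toReal_mul,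
    ENNReal.toReal_ofReal (faceWeight_nonneg k _), Measure.real]

theorem integral_skeleton (N k : ℕ) :
    ∫ x in simplexSkeleton N k, x ∂(μH[(k : ℝ)]) =
      ((μH[(k : ℝ)]).real (convexHull ℝ (Set.range (simplexVertex k))) / (k + 1)) •
        ∑ s ∈ Finset.powersetCard (k + 1) (Finset.univ : Finset (Fin (N + 1))),
          faceWeight k s • ∑ i ∈ s, simplexVertex N i := by
  rw [hausdorffMeasure_restrict_skeleton, Measure.sum_fintype,
    integral_finsetSum_measure fun s _ => integrableOn_id_face s.2, Finset.smul_sum,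
    Finset.sum_subtype (p := fun s : Finset (Fin (N + 1)) => s.card = k + 1) _ (by simp)]
  refine Finset.sum_congr rfl fun s _ => ?_
  rw [integral_face s.2, smul_smul, mul_comm]

theorem sum_faceWeight {N : ℕ} (k : ℕ) (U : Finset (Fin (N + 1))) :
    ∑ s ∈ Finset.powersetCard (k + 1) U, faceWeight k s =
      U.card.choose (k + 1) +
        (Real.sqrt (k + 1) - 1) * (U.erase 0).card.choose (k + 1) := by
  have hw : ∀ s : Finset (Fin (N + 1)),
      faceWeight k s = 1 + (Real.sqrt (k + 1) - 1) * if 0 ∉ s then 1 else 0 := by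
    intro s
    by_cases h : (0 : Fin (N + 1)) ∈ s <;> simp [faceWeight, h]
  have hf : (Finset.powersetCard (k + 1) U).filter (fun s => 0 ∉ s) =
      Finset.powersetCard (k + 1) (U.erase 0) := by
    ext s
    simp only [Finset.mem_filter, Finset.mem_powersetCard, Finset.subset_erase]
    tauto
  simp only [hw]
  rw [Finset.sum_add_distrib, ← Finset.mul_sum, Finset.sum_boole, hf]
  simp [Finset.card_powersetCard]

theorem sum_faceWeight_univ (N k : ℕ) :
    ∑ s ∈ Finset.powersetCard (k + 1) (Finset.univ : Finset (Fin (N + 1))), faceWeight k s =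
      N.choose k + Real.sqrt (k + 1) * N.choose (k + 1) := by
  rw [sum_faceWeight]
  simp only [Finset.card_univ, Fintype.card_fin, Finset.card_erase_of_mem (Finset.mem_univ _),
    Nat.add_sub_cancel, Nat.choose_succ_succ' N k]
  push_cast
  ring

theorem sum_faceWeight_filter_mem (n k : ℕ) (j : Fin (n + 1)) :
    ∑ s ∈ Finset.powersetCard (k + 1) (Finset.univ : Finset (Fin (n + 1 + 1))),
      (if j.succ ∈ s then faceWeight k s else 0) =
      (n + 1).choose k - n.choose k + Real.sqrt (k + 1) * n.choose k := by
  have hf : (Finset.powersetCard (k + 1) (Finset.univ : Finset (Fin (n + 1 + 1)))).filter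
      (fun s => j.succ ∉ s) = Finset.powersetCard (k + 1) (Finset.univ.erase j.succ) := by
    ext s
    simp only [Finset.mem_filter, Finset.mem_powersetCard, Finset.subset_erase]
    tauto
  have h := Finset.sum_filter_add_sum_filter_not
    (Finset.powersetCard (k + 1) (Finset.univ : Finset (Fin (n + 1 + 1))))
    (fun s => j.succ ∈ s) (faceWeight k)
  rw [hf, sum_faceWeight_univ, sum_faceWeight, Finset.card_erase_of_mem (a := 0)
      (by simp [(Fin.succ_ne_zero j).symm]), Finset.card_erase_of_mem (Finset.mem_univ _)] at h
  simp only [Finset.card_univ, Fintype.card_fin, Nat.add_sub_cancel,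
    Nat.choose_succ_succ' n k, Nat.cast_add] at h
  rw [← Finset.sum_filter]
  linear_combination h

theorem sum_faceWeight_smul_vertices (n k : ℕ) :
    ∑ s ∈ Finset.powersetCard (k + 1) (Finset.univ : Finset (Fin (n + 1 + 1))),
      faceWeight k s • ∑ i ∈ s, simplexVertex (n + 1) i =
      ((n + 1).choose k - n.choose k + Real.sqrt (k + 1) * n.choose k : ℝ) •
        ∑ j : Fin (n + 1), EuclideanSpace.single j (1 : ℝ) := by
  have hs : ∀ s : Finset (Fin (n + 1 + 1)), faceWeight k s • ∑ i ∈ s, simplexVertex (n + 1) i =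
      ∑ j : Fin (n + 1), (if j.succ ∈ s then faceWeight k s else 0) •
        EuclideanSpace.single j (1 : ℝ) := by
    intro s
    have h : ∑ i ∈ s, simplexVertex (n + 1) i =
        ∑ i, if i ∈ s then simplexVertex (n + 1) i else 0 := by simp
    rw [h, Fin.sum_univ_succ, simplexVertex_zero, ite_self, zero_add, Finset.smul_sum]
    refine Finset.sum_congr rfl fun j _ => ?_
    rw [simplexVertex_succ]
    split_ifs <;> simp
  simp only [hs]
  rw [Finset.sum_comm, Finset.smul_sum]
  refine Finset.sum_congr rfl fun j _ => ?_
  rw [← Finset.sum_smul, sum_faceWeight_filter_mem]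

/-- For `N ≥ 2` and `0 ≤ k ≤ N`, the centroid `C_{k,N}` of the `k`-skeleton of the
standard simplex in `ℝ^N` equals
`(1/N) · (k + (N-k)√(k+1)) / ((k+1) + (N-k)√(k+1)) · (e_1 + ⋯ + e_N)`. -/
theorem skeletonCentroid_eq (N k : ℕ) (hN : 2 ≤ N) (hk : k ≤ N) :
    skeletonCentroid N k =
      ((1 / (N : ℝ)) *
          (((k : ℝ) + ((N : ℝ) - (k : ℝ)) * Real.sqrt ((k : ℝ) + 1)) /
            (((k : ℝ) + 1) + ((N : ℝ) - (k : ℝ)) * Real.sqrt ((k : ℝ) + 1)))) •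
        ∑ j : Fin N, EuclideanSpace.single j (1 : ℝ) := by
  obtain ⟨n, rfl⟩ : ∃ n, N = n + 1 := ⟨N - 1, by omega⟩
  have hV := hausdorffMeasure_simplex_pos k
  rw [skeletonCentroid, hausdorffMeasure_skeleton, integral_skeleton,
    sum_faceWeight_smul_vertices, sum_faceWeight_univ, smul_smul, smul_smul]
  congr 1
  set V := (μH[(k : ℝ)]).real (convexHull ℝ (Set.range (simplexVertex k)))
  set r := Real.sqrt ((k : ℝ) + 1)
  have hr : 0 ≤ r := Real.sqrt_nonneg _
  have hkN : (k : ℝ) ≤ (n + 1 : ℕ) := by exact_mod_cast hk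
  have hC : (0 : ℝ) < (n + 1).choose k := by exact_mod_cast Nat.choose_pos hk
  have h1 : ((n + 1).choose (k + 1) : ℝ) * (k + 1) =
      (n + 1).choose k * ((n + 1 : ℕ) - k) := by
    rw [← Nat.cast_sub hk]
    exact_mod_cast Nat.choose_succ_right_eq (n + 1) k
  have h2 : ((n + 1 : ℕ) : ℝ) * n.choose k = (n + 1).choose k * ((n + 1 : ℕ) - k) := by
    rw [← h1]
    exact_mod_cast Nat.add_one_mul_choose_eq n k
  set C := (((n + 1).choose k : ℕ) : ℝ)
  set D := (((n + 1).choose (k + 1) : ℕ) : ℝ)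
  set E := ((n.choose k : ℕ) : ℝ)
  have hM : (0 : ℝ) < (n + 1 : ℕ) := by positivity
  set M : ℝ := ((n + 1 : ℕ) : ℝ)
  have hden : (0 : ℝ) < (k + 1) + (M - k) * r := by
    have := mul_nonneg (sub_nonneg.2 hkN) hr
    positivity
  have hW : (C + r * D) * (k + 1) = C * ((k + 1) + (M - k) * r) := by
    linear_combination r * h1
  have hWj : M * (C - E + r * E) = C * (k + (M - k) * r) := by
    linear_combination (r - 1) * h2
  have hWpos : 0 < C + r * D := by
    have : 0 < (C + r * D) * ((k : ℝ) + 1) := hW ▸ mul_pos hC hden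
    exact pos_of_mul_pos_left this (by positivity)
  have hk1 : (k : ℝ) + 1 ≠ 0 := by positivity
  calc ((C + r * D) * V)⁻¹ * (V / (k + 1)) * (C - E + r * E)
      = (M * (C - E + r * E)) / (M * ((C + r * D) * (k + 1))) := by field_simp
    _ = _ := by
      rw [hW, hWj]
      field_simp
end

section
/- For every integer N with 2 ≤ N ≤ 12, the centroids C_{1,N}, C_{2,N}, …, C_{N−1,N} of the intermediate skeletons of the standard simplex in ℝ^N are pairwise distinct, and each of them differs from the common centroid C_{0,N} = C_{N,N} of the vertex set and the solid simplex. -/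
open MeasureTheory

/-- The solid standard simplex. -/
def solidSimplex (k : ℕ) : Set (EuclideanSpace ℝ (Fin k)) :=
  convexHull ℝ (Set.range (simplexVertex k))

theorem isCompact_solidSimplex (k : ℕ) : IsCompact (solidSimplex k) :=
  (Set.finite_range _).isCompact_convexHull ℝ

theorem interior_solidSimplex_nonempty (k : ℕ) : (interior (solidSimplex k)).Nonempty := by
  rw [solidSimplex, interior_convexHull_nonempty_iff_affineSpan_eq_top,
    (affineIndependent_simplexVertex k).affineSpan_eq_top_iff_card_eq_finrank_add_one]
  simp

instance isAddHaarMeasure_hausdorffMeasure_euclideanSpace (k : ℕ) :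
    (μH[(k : ℝ)] : Measure (EuclideanSpace ℝ (Fin k))).IsAddHaarMeasure := by
  simpa using isAddHaarMeasure_hausdorffMeasure (E := EuclideanSpace ℝ (Fin k))

/-- The sum of the coordinates, as a linear functional. -/
noncomputable def coordSum (k : ℕ) : EuclideanSpace ℝ (Fin k) →ₗ[ℝ] ℝ :=
  ∑ i, (EuclideanSpace.proj i : EuclideanSpace ℝ (Fin k) →L[ℝ] ℝ).toLinearMap

theorem coordSum_apply {k : ℕ} (x : EuclideanSpace ℝ (Fin k)) : coordSum k x = ∑ i, x i := by
  simp [coordSum]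

/-- The linear part of the affine involution that exchanges the vertices `0` and `e_j`. -/
noncomputable def vertexSwapLinear {k : ℕ} (j : Fin k) :
    EuclideanSpace ℝ (Fin k) →ₗ[ℝ] EuclideanSpace ℝ (Fin k) :=
  LinearMap.transvection
    (-(coordSum k + (EuclideanSpace.proj j : EuclideanSpace ℝ (Fin k) →L[ℝ] ℝ).toLinearMap))
    (EuclideanSpace.single j 1)

theorem det_vertexSwapLinear {k : ℕ} (j : Fin k) : LinearMap.det (vertexSwapLinear j) = -1 := by
  rw [vertexSwapLinear, LinearMap.transvection.det]
  norm_num [coordSum_apply]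

/-- The affine involution of `ℝ^k` that exchanges the vertices `0` and `e_j`. -/
noncomputable def vertexSwap {k : ℕ} (j : Fin k) :
    EuclideanSpace ℝ (Fin k) →ᵃ[ℝ] EuclideanSpace ℝ (Fin k) :=
  (vertexSwapLinear j).toAffineMap + AffineMap.const ℝ _ (EuclideanSpace.single j 1)

theorem vertexSwap_apply {k : ℕ} (j : Fin k) (x : EuclideanSpace ℝ (Fin k)) :
    vertexSwap j x = x + (1 - ∑ i, x i - x j) • EuclideanSpace.single j 1 := by
  simp [vertexSwap, vertexSwapLinear, LinearMap.transvection.apply, coordSum_apply, sub_smul,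
    add_smul]
  abel

theorem vertexSwap_apply_self {k : ℕ} (j : Fin k) (x : EuclideanSpace ℝ (Fin k)) :
    vertexSwap j x j = 1 - ∑ i, x i := by
  simp [vertexSwap_apply]

theorem vertexSwap_involutive {k : ℕ} (j : Fin k) : Function.Involutive (vertexSwap j) := by
  intro x
  have h : ∑ i, vertexSwap j x i = 1 - x j := by
    simp [vertexSwap_apply, Finset.sum_add_distrib]
    ring
  rw [vertexSwap_apply j (vertexSwap j x), h, vertexSwap_apply_self, vertexSwap_apply]
  simp only [sub_smul]
  abel

theorem vertexSwap_mapsTo {k : ℕ} (j : Fin k) :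
    Set.MapsTo (vertexSwap j) (solidSimplex k) (solidSimplex k) := by
  rw [Set.mapsTo_iff_image_subset, solidSimplex, AffineMap.image_convexHull]
  refine convexHull_mono ?_
  rintro _ ⟨_, ⟨i, rfl⟩, rfl⟩
  refine Fin.cases ⟨j.succ, ?_⟩ (fun i => ?_) i
  · simp [simplexVertex_zero, simplexVertex_succ, vertexSwap_apply]
  · by_cases h : i = j
    · subst h
      refine ⟨0, ?_⟩
      simp [simplexVertex_zero, simplexVertex_succ, vertexSwap_apply]
    · refine ⟨i.succ, ?_⟩
      simp [simplexVertex_succ, vertexSwap_apply, Ne.symm h]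

theorem vertexSwap_preimage {k : ℕ} (j : Fin k) :
    vertexSwap j ⁻¹' solidSimplex k = solidSimplex k := by
  refine Set.Subset.antisymm (fun x hx => ?_) (vertexSwap_mapsTo j)
  rw [← vertexSwap_involutive j x]
  exact vertexSwap_mapsTo j hx

theorem measurePreserving_vertexSwap {k : ℕ} (j : Fin k)
    (μ : Measure (EuclideanSpace ℝ (Fin k))) [μ.IsAddHaarMeasure] :
    MeasurePreserving (vertexSwap j) μ μ := by
  have h₁ : MeasurePreserving (vertexSwapLinear j) μ μ := by
    refine ⟨(vertexSwapLinear j).continuous_of_finiteDimensional.measurable, ?_⟩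
    rw [Measure.map_linearMap_addHaar_eq_smul_addHaar] <;> simp [det_vertexSwapLinear]
  exact (measurePreserving_add_right μ (EuclideanSpace.single j (1 : ℝ))).comp h₁

theorem integral_coord_solidSimplex {k : ℕ} (j : Fin k)
    (μ : Measure (EuclideanSpace ℝ (Fin k))) [μ.IsAddHaarMeasure] :
    ∫ x in solidSimplex k, x j ∂μ = μ.real (solidSimplex k) / (k + 1) := by
  have hint : ∀ i : Fin k, IntegrableOn (fun x : EuclideanSpace ℝ (Fin k) => x i)
      (solidSimplex k) μ := fun i =>
    (by fun_prop : Continuous fun x : EuclideanSpace ℝ (Fin k) => x i).continuousOn.integrableOn_compact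
      (isCompact_solidSimplex k)
  have hswap : ∀ i : Fin k, ∫ x in solidSimplex k, x i ∂μ =
      μ.real (solidSimplex k) - ∑ l, ∫ x in solidSimplex k, x l ∂μ := by
    intro i
    have hm := (measurePreserving_vertexSwap i μ).restrict_preimage
      (isCompact_solidSimplex k).measurableSet
    rw [vertexSwap_preimage] at hm
    have hfin : IsFiniteMeasure (μ.restrict (solidSimplex k)) :=
      isFiniteMeasure_restrict.2 (isCompact_solidSimplex k).measure_ne_top
    conv_lhs => rw [← hm.map_eq]
    rw [integral_map hm.measurable.aemeasurable
      (by fun_prop : Continuous fun x : EuclideanSpace ℝ (Fin k) => x i).aestronglyMeasurable]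
    simp only [vertexSwap_apply_self]
    rw [integral_sub (integrable_const _) (integrable_finsetSum _ fun l _ => hint l),
      integral_finsetSum _ fun l _ => hint l]
    simp
  have hsum : ∑ l, ∫ x in solidSimplex k, x l ∂μ = k * ∫ x in solidSimplex k, x j ∂μ := by
    rw [Finset.sum_congr rfl fun l _ => (hswap l).trans (hswap j).symm]
    simp
  have hj := hswap j
  rw [hsum] at hj
  field_simp
  linarith
/-- The affine map sending the vertices of the standard simplex of `ℝ^k` to the vertices of the
standard simplex of `ℝ^N` selected by `p`. -/
noncomputable def faceMap {N k : ℕ} (p : Fin (k + 1) → Fin (N + 1)) :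
    EuclideanSpace ℝ (Fin k) →ᵃ[ℝ] EuclideanSpace ℝ (Fin N) :=
  (∑ j : Fin k, (EuclideanSpace.proj j : EuclideanSpace ℝ (Fin k) →L[ℝ] ℝ).toLinearMap.smulRight
    (simplexVertex N (p j.succ) - simplexVertex N (p 0))).toAffineMap +
    AffineMap.const ℝ _ (simplexVertex N (p 0))

theorem faceMap_apply {N k : ℕ} (p : Fin (k + 1) → Fin (N + 1)) (x : EuclideanSpace ℝ (Fin k)) :
    faceMap p x = ∑ j, x j • (simplexVertex N (p j.succ) - simplexVertex N (p 0)) +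
      simplexVertex N (p 0) := by
  simp [faceMap]

theorem faceMap_simplexVertex {N k : ℕ} (p : Fin (k + 1) → Fin (N + 1)) (i : Fin (k + 1)) :
    faceMap p (simplexVertex k i) = simplexVertex N (p i) := by
  refine Fin.cases ?_ (fun i => ?_) i
  · simp [faceMap_apply, simplexVertex_zero]
  · simp [faceMap_apply, simplexVertex_succ]

theorem continuous_faceMap {N k : ℕ} (p : Fin (k + 1) → Fin (N + 1)) : Continuous (faceMap p) :=
  (faceMap p).continuous_of_finiteDimensional

theorem faceMap_image_solidSimplex {N k : ℕ} (p : Fin (k + 1) → Fin (N + 1)) :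
    faceMap p '' solidSimplex k = convexHull ℝ (simplexVertex N '' Set.range p) := by
  rw [solidSimplex, AffineMap.image_convexHull, ← Set.range_comp, ← Set.range_comp]
  congr 2
  funext i
  exact faceMap_simplexVertex p i

/-- A linear model with determinant `√(k+1)` for the distances on a face missing the origin. -/
noncomputable def regularModel (k : ℕ) : EuclideanSpace ℝ (Fin k) →ₗ[ℝ] EuclideanSpace ℝ (Fin k) :=
  LinearMap.transvection ((1 / (√(k + 1) + 1)) • coordSum k) (WithLp.toLp 2 fun _ => 1)

theorem det_regularModel (k : ℕ) : LinearMap.det (regularModel k) = √(k + 1) := by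
  rw [regularModel, LinearMap.transvection.det]
  simp [coordSum_apply]
  have h : √((k : ℝ) + 1) ^ 2 = k + 1 := Real.sq_sqrt (by positivity)
  have : 0 ≤ √((k : ℝ) + 1) := Real.sqrt_nonneg _
  field_simp
  linarith

theorem norm_sq_regularModel {k : ℕ} (x : EuclideanSpace ℝ (Fin k)) :
    ‖regularModel k x‖ ^ 2 = ∑ i, x i ^ 2 + (∑ i, x i) ^ 2 := by
  have h : √((k : ℝ) + 1) ^ 2 = k + 1 := Real.sq_sqrt (by positivity)
  have h0 : 0 ≤ √((k : ℝ) + 1) := Real.sqrt_nonneg _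
  rw [EuclideanSpace.norm_sq_eq]
  simp [regularModel, LinearMap.transvection.apply, coordSum_apply, add_sq,
    Finset.sum_add_distrib, ← Finset.sum_mul, ← Finset.mul_sum]
  have h1 : (√((k : ℝ) + 1) + 1) ≠ 0 := by positivity
  field_simp
  linear_combination -(∑ i, x i) ^ 2 * h

theorem norm_sq_sum_smul_simplexVertex_succ {N : ℕ} {ι : Type*} [Fintype ι] {q : ι → Fin N}
    (hq : Function.Injective q) (w : ι → ℝ) :
    ‖∑ j, w j • simplexVertex N (q j).succ‖ ^ 2 = ∑ j, w j ^ 2 := by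
  have h := ((EuclideanSpace.basisFun (Fin N) ℝ).orthonormal.comp q hq).inner_sum w w Finset.univ
  simp only [simplexVertex_succ]
  rw [← real_inner_self_eq_norm_sq]
  simpa [pow_two] using h

/-- The linear model for the distances on a face: an isometric copy when the first vertex is the
origin, the regular model otherwise. -/
noncomputable def faceModel (k : ℕ) (b : Prop) [Decidable b] :
    EuclideanSpace ℝ (Fin k) →ₗ[ℝ] EuclideanSpace ℝ (Fin k) :=
  if b then LinearMap.id else regularModel k

theorem det_faceModel (k : ℕ) (b : Prop) [Decidable b] :
    LinearMap.det (faceModel k b) = if b then 1 else √(k + 1) := by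
  unfold faceModel
  split_ifs
  · simp
  · exact det_regularModel k

theorem dist_faceMap {N k : ℕ} {p : Fin (k + 1) → Fin (N + 1)} (hp : StrictMono p)
    (x y : EuclideanSpace ℝ (Fin k)) :
    dist (faceMap p x) (faceMap p y) =
      dist (faceModel k (p 0 = 0) x) (faceModel k (p 0 = 0) y) := by
  have hxy : faceMap p x - faceMap p y =
      ∑ j, (x - y) j • (simplexVertex N (p j.succ) - simplexVertex N (p 0)) := by
    simp only [faceMap_apply, add_sub_add_right_eq_sub, ← Finset.sum_sub_distrib, ← sub_smul]
    rfl
  rw [dist_eq_norm, dist_eq_norm, hxy, ← map_sub]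
  generalize x - y = z
  rw [← sq_eq_sq₀ (norm_nonneg _) (norm_nonneg _)]
  by_cases h0 : p 0 = 0
  · have hne : ∀ j : Fin k, p j.succ ≠ 0 := fun j hj =>
      Fin.succ_ne_zero j (hp.injective (hj.trans h0.symm))
    have hq : Function.Injective fun j : Fin k => (p j.succ).pred (hne j) := fun i j hij =>
      Fin.succ_injective _ (hp.injective (Fin.pred_inj.mp hij))
    have h := norm_sq_sum_smul_simplexVertex_succ hq fun j => z j
    simp only [Fin.succ_pred] at h
    simp [faceModel, h0, simplexVertex_zero, h, EuclideanSpace.norm_sq_eq]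
  · have hne : ∀ j : Fin (k + 1), p j ≠ 0 := fun j =>
      ((Fin.pos_iff_ne_zero.mpr h0).trans_le (hp.monotone (Fin.zero_le j))).ne'
    have hq : Function.Injective fun j : Fin (k + 1) => (p j).pred (hne j) := fun i j hij =>
      hp.injective (Fin.pred_inj.mp hij)
    have h := norm_sq_sum_smul_simplexVertex_succ hq (Fin.cons (-∑ j, z j) fun j => z j)
    simp only [Fin.succ_pred, Fin.sum_univ_succ, Fin.cons_zero, Fin.cons_succ] at h
    simp only [faceModel, h0, if_false, norm_sq_regularModel, smul_sub, Finset.sum_sub_distrib,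
      ← Finset.sum_smul]
    rw [sub_eq_neg_add, ← neg_smul, h]
    ring

theorem hausdorffMeasure_restrict_range_eq_smul_map {k : ℕ} {F : Type*} [MetricSpace F]
    [MeasurableSpace F] [BorelSpace F]
    {A : EuclideanSpace ℝ (Fin k) → F}
    {B : EuclideanSpace ℝ (Fin k) →ₗ[ℝ] EuclideanSpace ℝ (Fin k)} (hB : LinearMap.det B ≠ 0)
    (hAB : ∀ x y, dist (A x) (A y) = dist (B x) (B y)) :
    (μH[(k : ℝ)] : Measure F).restrict (Set.range A) =
      ENNReal.ofReal |LinearMap.det B| • Measure.map A μH[(k : ℝ)] := by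
  let e : EuclideanSpace ℝ (Fin k) ≃ₗ[ℝ] EuclideanSpace ℝ (Fin k) :=
    LinearEquiv.ofIsUnitDet (v := PiLp.basisFun 2 ℝ (Fin k)) (v' := PiLp.basisFun 2 ℝ (Fin k))
      (f := B) (by simpa using hB)
  have he : ∀ x, e x = B x := fun x => rfl
  have hφ : Isometry (A ∘ e.symm) := by
    refine Isometry.of_dist_eq fun x y => ?_
    simp [hAB, ← he]
  have hr : Set.range (A ∘ e.symm) = Set.range A := e.symm.surjective.range_comp A
  have hA : A = (A ∘ e.symm) ∘ B := by
    funext x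
    simp [← he]
  have hBc : Continuous B := B.continuous_of_finiteDimensional
  have hBm : Measure.map B μH[(k : ℝ)] =
      ENNReal.ofReal |(LinearMap.det B)⁻¹| • μH[(k : ℝ)] :=
    Measure.map_linearMap_addHaar_eq_smul_addHaar _ hB
  rw [← hr, ← hφ.map_hausdorffMeasure (Or.inl (by positivity))]
  conv_rhs => rw [hA, ← Measure.map_map hφ.continuous.measurable hBc.measurable, hBm]
  rw [Measure.map_smul, smul_smul, ← ENNReal.ofReal_mul (abs_nonneg _), ← abs_mul,
    mul_inv_cancel₀ hB]
  simp

/-- The factor by which a face is larger than the solid standard simplex of its dimension. -/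
noncomputable def faceScale (k : ℕ) (b : Prop) [Decidable b] : ℝ := if b then 1 else √(k + 1)

theorem faceScale_pos (k : ℕ) (b : Prop) [Decidable b] : 0 < faceScale k b := by
  unfold faceScale
  split_ifs <;> positivity

theorem faceMap_injective {N k : ℕ} {p : Fin (k + 1) → Fin (N + 1)} (hp : StrictMono p) :
    Function.Injective (faceMap p) := by
  intro x y hxy
  have hd : LinearMap.det (faceModel k (p 0 = 0)) ≠ 0 := by
    rw [det_faceModel]
    exact (faceScale_pos k (p 0 = 0)).ne'
  have h := dist_faceMap hp x y
  rw [hxy, dist_self] at h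
  exact (LinearMap.equivOfDetNeZero _ hd).injective (dist_eq_zero.mp h.symm)

theorem hausdorffMeasure_restrict_face_s13 {N k : ℕ} {p : Fin (k + 1) → Fin (N + 1)}
    (hp : StrictMono p) :
    (μH[(k : ℝ)] : Measure (EuclideanSpace ℝ (Fin N))).restrict (faceMap p '' solidSimplex k) =
      ENNReal.ofReal (faceScale k (p 0 = 0)) •
        Measure.map (faceMap p) (μH[(k : ℝ)].restrict (solidSimplex k)) := by
  have hpos := faceScale_pos k (p 0 = 0)
  have hdet : LinearMap.det (faceModel k (p 0 = 0)) = faceScale k (p 0 = 0) := det_faceModel _ _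
  have h := hausdorffMeasure_restrict_range_eq_smul_map (hdet ▸ hpos.ne') (dist_faceMap hp)
  rw [hdet, abs_of_pos hpos] at h
  have hm : MeasurableSet (faceMap p '' solidSimplex k) :=
    ((isCompact_solidSimplex k).image (continuous_faceMap p)).measurableSet
  rw [← Measure.restrict_restrict_of_subset (Set.image_subset_range _ _), h,
    Measure.restrict_smul, Measure.restrict_map (continuous_faceMap p).measurable hm,
    Set.preimage_image_eq _ (faceMap_injective hp)]

theorem hausdorffMeasure_real_solidSimplex_pos (k : ℕ) :
    0 < (μH[(k : ℝ)] : Measure (EuclideanSpace ℝ (Fin k))).real (solidSimplex k) :=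
  ENNReal.toReal_pos
    (Measure.measure_pos_of_nonempty_interior _ (interior_solidSimplex_nonempty k)).ne'
    (isCompact_solidSimplex k).measure_ne_top

theorem hausdorffMeasure_face_s13 {N k : ℕ} {p : Fin (k + 1) → Fin (N + 1)} (hp : StrictMono p) :
    (μH[(k : ℝ)] : Measure (EuclideanSpace ℝ (Fin N))) (faceMap p '' solidSimplex k) =
      ENNReal.ofReal (faceScale k (p 0 = 0) *
        (μH[(k : ℝ)] : Measure (EuclideanSpace ℝ (Fin k))).real (solidSimplex k)) := by
  have h := congrArg (fun μ => μ Set.univ) (hausdorffMeasure_restrict_face_s13 hp)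
  simp only [Measure.restrict_apply_univ, Measure.smul_apply, smul_eq_mul] at h
  rw [Measure.map_apply (continuous_faceMap p).measurable MeasurableSet.univ, Set.preimage_univ,
    Measure.restrict_apply_univ] at h
  rw [h, ENNReal.ofReal_mul (faceScale_pos _ _).le, Measure.real,
    ENNReal.ofReal_toReal (isCompact_solidSimplex k).measure_ne_top]

theorem integrableOn_face {N k : ℕ} {p : Fin (k + 1) → Fin (N + 1)} (hp : StrictMono p) :
    IntegrableOn (fun x : EuclideanSpace ℝ (Fin N) => x) (faceMap p '' solidSimplex k)
      μH[(k : ℝ)] := by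
  rw [IntegrableOn, hausdorffMeasure_restrict_face_s13 hp]
  refine Integrable.smul_measure ?_ ENNReal.ofReal_ne_top
  rw [integrable_map_measure continuous_id'.aestronglyMeasurable
    (continuous_faceMap p).measurable.aemeasurable]
  exact (continuous_faceMap p).continuousOn.integrableOn_compact (isCompact_solidSimplex k)

theorem integral_faceMap {N k : ℕ} (p : Fin (k + 1) → Fin (N + 1))
    (μ : Measure (EuclideanSpace ℝ (Fin k))) [μ.IsAddHaarMeasure] :
    ∫ x in solidSimplex k, faceMap p x ∂μ =
      (μ.real (solidSimplex k) / (k + 1)) • ∑ j, simplexVertex N (p j) := by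
  have hint : ∀ i : Fin k, IntegrableOn (fun x : EuclideanSpace ℝ (Fin k) => x i)
      (solidSimplex k) μ := fun i => (by fun_prop : Continuous fun x : EuclideanSpace ℝ (Fin k) =>
        x i).continuousOn.integrableOn_compact (isCompact_solidSimplex k)
  have hfin : IsFiniteMeasure (μ.restrict (solidSimplex k)) :=
    isFiniteMeasure_restrict.2 (isCompact_solidSimplex k).measure_ne_top
  simp only [faceMap_apply]
  rw [integral_add (integrable_finsetSum _ fun l _ => (hint l).smul_const _)
    (integrable_const _), integral_finsetSum _ fun l _ => (hint l).smul_const _]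
  simp only [integral_smul_const, integral_coord_solidSimplex, integral_const,
    measureReal_restrict_apply_univ]
  rw [Fin.sum_univ_succ, ← Finset.smul_sum, Finset.sum_sub_distrib, smul_add, smul_sub]
  simp only [Finset.sum_const, Finset.card_univ, Fintype.card_fin, ← Nat.cast_smul_eq_nsmul ℝ,
    smul_smul]
  obtain ⟨c, hc⟩ : ∃ c, c = μ.real (solidSimplex k) / ((k : ℝ) + 1) := ⟨_, rfl⟩
  have hμ : μ.real (solidSimplex k) = c * (k + 1) := by
    rw [hc]
    field_simp
  rw [← hc, hμ]
  module

theorem integral_face_s13 {N k : ℕ} {p : Fin (k + 1) → Fin (N + 1)} (hp : StrictMono p) :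
    ∫ x in faceMap p '' solidSimplex k, x ∂(μH[(k : ℝ)] : Measure (EuclideanSpace ℝ (Fin N))) =
      (faceScale k (p 0 = 0) *
        (μH[(k : ℝ)] : Measure (EuclideanSpace ℝ (Fin k))).real (solidSimplex k) / (k + 1)) •
          ∑ j, simplexVertex N (p j) := by
  rw [hausdorffMeasure_restrict_face_s13 hp, integral_smul_measure,
    integral_map (continuous_faceMap p).measurable.aemeasurable
      continuous_id'.aestronglyMeasurable, integral_faceMap, smul_smul,
    ENNReal.toReal_ofReal (faceScale_pos _ _).le, mul_div_assoc]

/-- The face of the standard simplex spanned by a set of vertices. -/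
def simplexFace (N : ℕ) (s : Finset (Fin (N + 1))) : Set (EuclideanSpace ℝ (Fin N)) :=
  convexHull ℝ (simplexVertex N '' ↑s)

theorem simplexFace_eq_image {N k : ℕ} {s : Finset (Fin (N + 1))} (hs : s.card = k + 1) :
    simplexFace N s = faceMap (s.orderEmbOfFin hs) '' solidSimplex k := by
  rw [faceMap_image_solidSimplex, Finset.range_orderEmbOfFin, simplexFace]

theorem isCompact_simplexFace (N : ℕ) (s : Finset (Fin (N + 1))) : IsCompact (simplexFace N s) :=
  (s.finite_toSet.image _).isCompact_convexHull ℝ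

theorem orderEmbOfFin_zero_eq_zero_iff {N k : ℕ} {s : Finset (Fin (N + 1))}
    (hs : s.card = k + 1) : s.orderEmbOfFin hs 0 = 0 ↔ 0 ∈ s := by
  refine ⟨fun h => h ▸ s.orderEmbOfFin_mem hs 0, fun h => ?_⟩
  rw [← Finset.mem_coe, ← Finset.range_orderEmbOfFin s hs] at h
  obtain ⟨j, hj⟩ := h
  exact Fin.le_zero_iff.mp (hj ▸ (s.orderEmbOfFin hs).monotone (Fin.zero_le j))

theorem faceScale_orderEmbOfFin {N k : ℕ} {s : Finset (Fin (N + 1))} (hs : s.card = k + 1) :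
    faceScale k (s.orderEmbOfFin hs 0 = 0) = faceScale k (0 ∈ s) := by
  simp only [faceScale, orderEmbOfFin_zero_eq_zero_iff]

theorem hausdorffMeasure_simplexFace {N k : ℕ} {s : Finset (Fin (N + 1))} (hs : s.card = k + 1) :
    (μH[(k : ℝ)] : Measure (EuclideanSpace ℝ (Fin N))) (simplexFace N s) =
      ENNReal.ofReal (faceScale k (0 ∈ s) *
        (μH[(k : ℝ)] : Measure (EuclideanSpace ℝ (Fin k))).real (solidSimplex k)) := by
  rw [simplexFace_eq_image hs, hausdorffMeasure_face_s13 (s.orderEmbOfFin hs).strictMono,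
    faceScale_orderEmbOfFin]

theorem integrableOn_simplexFace {N k : ℕ} {s : Finset (Fin (N + 1))} (hs : s.card = k + 1) :
    IntegrableOn (fun x : EuclideanSpace ℝ (Fin N) => x) (simplexFace N s) μH[(k : ℝ)] := by
  rw [simplexFace_eq_image hs]
  exact integrableOn_face (s.orderEmbOfFin hs).strictMono

theorem integral_simplexFace {N k : ℕ} {s : Finset (Fin (N + 1))} (hs : s.card = k + 1) :
    ∫ x in simplexFace N s, x ∂(μH[(k : ℝ)] : Measure (EuclideanSpace ℝ (Fin N))) =
      (faceScale k (0 ∈ s) *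
        (μH[(k : ℝ)] : Measure (EuclideanSpace ℝ (Fin k))).real (solidSimplex k) / (k + 1)) •
          ∑ i ∈ s, simplexVertex N i := by
  rw [simplexFace_eq_image hs, integral_face_s13 (s.orderEmbOfFin hs).strictMono,
    faceScale_orderEmbOfFin]
  congr 1
  conv_rhs => rw [← Finset.map_orderEmbOfFin_univ s hs, Finset.sum_map]
  rfl

theorem hausdorffMeasure_simplexFace_eq_zero {N k : ℕ} {s : Finset (Fin (N + 1))}
    (hs : s.card ≤ k) :
    (μH[(k : ℝ)] : Measure (EuclideanSpace ℝ (Fin N))) (simplexFace N s) = 0 := by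
  obtain rfl | hne := s.eq_empty_or_nonempty
  · simp [simplexFace]
  · obtain ⟨m, hm⟩ := Nat.exists_eq_add_of_le' hne.card_pos
    refine (Measure.hausdorffMeasure_zero_or_top (d₁ := m) (d₂ := k) ?_ _).resolve_right ?_
    · exact_mod_cast (by omega : m < k)
    · rw [hausdorffMeasure_simplexFace hm]
      exact ENNReal.ofReal_ne_top

theorem simplexFace_inter {N : ℕ} (s t : Finset (Fin (N + 1))) :
    simplexFace N s ∩ simplexFace N t = simplexFace N (s ∩ t) := by
  classical
  have hinj := (affineIndependent_simplexVertex N).injective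
  have h := AffineIndependent.convexHull_inter (R := ℝ) (s := Finset.univ.image (simplexVertex N))
    (t₁ := s.image (simplexVertex N)) (t₂ := t.image (simplexVertex N))
    (by
      have h := (affineIndependent_simplexVertex N).range
      rwa [← Set.image_univ, ← Finset.coe_univ, ← Finset.coe_image] at h)
    (Finset.image_subset_image s.subset_univ) (Finset.image_subset_image t.subset_univ)
  rw [simplexFace, simplexFace, simplexFace, Finset.coe_inter, Set.image_inter hinj]
  simpa using h.symm

theorem aedisjoint_simplexFace {N k : ℕ} {s t : Finset (Fin (N + 1))} (hs : s.card = k + 1)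
    (ht : t.card = k + 1) (hst : s ≠ t) :
    AEDisjoint (μH[(k : ℝ)] : Measure (EuclideanSpace ℝ (Fin N)))
      (simplexFace N s) (simplexFace N t) := by
  rw [AEDisjoint, simplexFace_inter]
  refine hausdorffMeasure_simplexFace_eq_zero (Nat.lt_succ_iff.mp ?_)
  rw [Nat.succ_eq_add_one, ← hs]
  refine Finset.card_lt_card (Finset.inter_subset_left.ssubset_of_ne fun h => hst ?_)
  exact Finset.eq_of_subset_of_card_le (Finset.inter_eq_left.mp h) (by omega)

theorem simplexSkeleton_eq_iUnion (N k : ℕ) :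
    simplexSkeleton N k =
      ⋃ s : ↥((Finset.univ : Finset (Fin (N + 1))).powersetCard (k + 1)), simplexFace N s := by
  ext x
  simp [simplexSkeleton, simplexFace]

theorem skeleton_pairwise_aedisjoint (N k : ℕ) :
    Pairwise (Function.onFun (AEDisjoint (μH[(k : ℝ)] : Measure (EuclideanSpace ℝ (Fin N))))
      fun s : ↥((Finset.univ : Finset (Fin (N + 1))).powersetCard (k + 1)) => simplexFace N s) :=
  fun s t hst => aedisjoint_simplexFace (Finset.mem_powersetCard.mp s.2).2
    (Finset.mem_powersetCard.mp t.2).2 fun h => hst (Subtype.ext h)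

theorem hausdorffMeasure_simplexSkeleton (N k : ℕ) :
    ((μH[(k : ℝ)] : Measure (EuclideanSpace ℝ (Fin N))) (simplexSkeleton N k)).toReal =
      (∑ s ∈ (Finset.univ : Finset (Fin (N + 1))).powersetCard (k + 1), faceScale k (0 ∈ s)) *
        (μH[(k : ℝ)] : Measure (EuclideanSpace ℝ (Fin k))).real (solidSimplex k) := by
  rw [simplexSkeleton_eq_iUnion, measure_iUnion₀ (skeleton_pairwise_aedisjoint N k)
    fun s => (isCompact_simplexFace N s).measurableSet.nullMeasurableSet, tsum_fintype,
    Finset.sum_coe_sort _ fun s => (μH[(k : ℝ)] : Measure (EuclideanSpace ℝ (Fin N)))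
      (simplexFace N s), Finset.sum_mul]
  rw [Finset.sum_congr rfl fun s hs =>
    hausdorffMeasure_simplexFace (Finset.mem_powersetCard.mp hs).2,
    ENNReal.toReal_sum fun _ _ => ENNReal.ofReal_ne_top]
  refine Finset.sum_congr rfl fun s _ => ENNReal.toReal_ofReal ?_
  exact mul_nonneg (faceScale_pos _ _).le measureReal_nonneg

theorem integral_simplexSkeleton (N k : ℕ) :
    ∫ x in simplexSkeleton N k, x ∂(μH[(k : ℝ)] : Measure (EuclideanSpace ℝ (Fin N))) =
      ((μH[(k : ℝ)] : Measure (EuclideanSpace ℝ (Fin k))).real (solidSimplex k) / (k + 1)) •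
        ∑ s ∈ (Finset.univ : Finset (Fin (N + 1))).powersetCard (k + 1),
          faceScale k (0 ∈ s) • ∑ i ∈ s, simplexVertex N i := by
  have hm : ∀ s : ↥((Finset.univ : Finset (Fin (N + 1))).powersetCard (k + 1)),
      NullMeasurableSet (simplexFace N s) (μH[(k : ℝ)] : Measure (EuclideanSpace ℝ (Fin N))) :=
    fun s => (isCompact_simplexFace N s).measurableSet.nullMeasurableSet
  rw [simplexSkeleton_eq_iUnion, integral_iUnion_ae hm (skeleton_pairwise_aedisjoint N k),
    tsum_fintype, Finset.sum_coe_sort _ fun s => ∫ x in simplexFace N s, x ∂μH[(k : ℝ)],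
    Finset.smul_sum]
  · refine Finset.sum_congr rfl fun s hs => ?_
    rw [integral_simplexFace (Finset.mem_powersetCard.mp hs).2, smul_smul]
    congr 1
    ring
  · exact integrableOn_finite_iUnion.mpr fun s =>
      integrableOn_simplexFace (Finset.mem_powersetCard.mp s.2).2

theorem skeletonCentroid_eq_s13 (N k : ℕ) :
    skeletonCentroid N k =
      ((k + 1) * ∑ s ∈ (Finset.univ : Finset (Fin (N + 1))).powersetCard (k + 1),
        faceScale k (0 ∈ s))⁻¹ •
        ∑ s ∈ (Finset.univ : Finset (Fin (N + 1))).powersetCard (k + 1),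
          faceScale k (0 ∈ s) • ∑ i ∈ s, simplexVertex N i := by
  have hpos := hausdorffMeasure_real_solidSimplex_pos k
  rw [skeletonCentroid, hausdorffMeasure_simplexSkeleton, integral_simplexSkeleton, smul_smul]
  congr 1
  rw [mul_inv, mul_inv]
  field_simp

theorem filter_notMem_powersetCard {α : Type*} [DecidableEq α] (u : Finset α) (a : α) (m : ℕ) :
    (u.powersetCard m).filter (a ∉ ·) = (u.erase a).powersetCard m := by
  ext s
  simp only [Finset.mem_filter, Finset.mem_powersetCard, Finset.subset_erase]
  tauto

theorem card_filter_mem_powersetCard {α : Type*} [DecidableEq α] {u : Finset α} {a : α}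
    (ha : a ∈ u) (m : ℕ) :
    ((u.powersetCard (m + 1)).filter (a ∈ ·)).card = (u.card - 1).choose m := by
  have h := Finset.card_filter_add_card_filter_not (s := u.powersetCard (m + 1)) (a ∈ ·)
  rw [filter_notMem_powersetCard, Finset.card_powersetCard, Finset.card_powersetCard,
    Finset.card_erase_of_mem ha] at h
  obtain ⟨n, hn⟩ := Nat.exists_eq_add_of_le' (Finset.card_pos.mpr ⟨a, ha⟩)
  rw [hn, Nat.choose_succ_succ'] at h
  rw [hn]
  simp only [Nat.add_sub_cancel] at h ⊢
  omega

theorem faceScale_eq_add (k : ℕ) (b : Prop) [Decidable b] :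
    faceScale k b = 1 + (√(k + 1) - 1) * if ¬b then 1 else 0 := by
  by_cases h : b <;> simp [faceScale, h]

theorem sum_faceScale (N k : ℕ) :
    ∑ s ∈ (Finset.univ : Finset (Fin (N + 1))).powersetCard (k + 1), faceScale k (0 ∈ s) =
      (N + 1).choose (k + 1) + (√(k + 1) - 1) * N.choose (k + 1) := by
  simp only [faceScale_eq_add, Finset.sum_add_distrib, ← Finset.mul_sum]
  rw [Finset.sum_boole, filter_notMem_powersetCard]
  simp [Finset.card_erase_of_mem]

theorem sum_faceScale_mem {N : ℕ} (k : ℕ) (i : Fin N) :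
    ∑ s ∈ ((Finset.univ : Finset (Fin (N + 1))).powersetCard (k + 1)).filter (i.succ ∈ ·),
      faceScale k (0 ∈ s) = N.choose k + (√(k + 1) - 1) * (N - 1).choose k := by
  simp only [faceScale_eq_add, Finset.sum_add_distrib, ← Finset.mul_sum]
  rw [Finset.sum_boole, Finset.filter_comm, filter_notMem_powersetCard,
    card_filter_mem_powersetCard (by simp [Fin.succ_ne_zero])]
  rw [Finset.sum_const, card_filter_mem_powersetCard (Finset.mem_univ _)]
  simp [Finset.card_erase_of_mem]

theorem sum_simplexVertex_apply {N : ℕ} (s : Finset (Fin (N + 1))) (i : Fin N) :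
    (∑ j ∈ s, simplexVertex N j) i = if i.succ ∈ s then 1 else 0 := by
  have h : ∀ j : Fin (N + 1), simplexVertex N j i = if i.succ = j then 1 else 0 := by
    intro j
    refine Fin.cases ?_ (fun j => ?_) j
    · simp [simplexVertex_zero, Fin.succ_ne_zero]
    · simp [simplexVertex_succ]
  simp [h]

/-- The coordinates of the centroid of the `k`-skeleton are `(1 - 1 / g) / N` with `g` this
number. -/
noncomputable def centroidParam (N k : ℕ) : ℝ := k + 1 + √(k + 1) * (N - k)

theorem one_le_centroidParam {N k : ℕ} (hk : k ≤ N) : 1 ≤ centroidParam N k := by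
  have : (k : ℝ) ≤ N := by exact_mod_cast hk
  have : 0 ≤ √((k : ℝ) + 1) * (N - k) := mul_nonneg (Real.sqrt_nonneg _) (by linarith)
  unfold centroidParam
  linarith [(Nat.cast_nonneg k : (0 : ℝ) ≤ k)]

theorem skeletonCentroid_apply {N k : ℕ} (hk : k ≤ N) (i : Fin N) :
    skeletonCentroid N k i = (1 - (centroidParam N k)⁻¹) / N := by
  have hN : 0 < N := i.pos
  rw [skeletonCentroid_eq_s13, sum_faceScale]
  have hsum : (∑ s ∈ (Finset.univ : Finset (Fin (N + 1))).powersetCard (k + 1),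
      faceScale k (0 ∈ s) • ∑ j ∈ s, simplexVertex N j) i =
      N.choose k + (√(k + 1) - 1) * (N - 1).choose k := by
    rw [← sum_faceScale_mem k i, Finset.sum_filter]
    rw [WithLp.ofLp_sum, Finset.sum_apply]
    refine Finset.sum_congr rfl fun s _ => ?_
    rw [PiLp.smul_apply, sum_simplexVertex_apply, smul_eq_mul, mul_ite, mul_one, mul_zero]
  rw [PiLp.smul_apply, hsum, smul_eq_mul]
  have h₁ : ((k : ℝ) + 1) * (N + 1).choose (k + 1) = (N + 1) * N.choose k := by
    have := Nat.add_one_mul_choose_eq N k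
    rw [mul_comm]
    exact_mod_cast this.symm
  have h₂ : ((k : ℝ) + 1) * N.choose (k + 1) = N.choose k * (N - k) := by
    have := Nat.choose_succ_right_eq N k
    rw [← Nat.cast_sub hk, mul_comm]
    exact_mod_cast this
  have h₃ : (N : ℝ) * (N - 1).choose k = N.choose k * (N - k) := by
    have := Nat.choose_mul_succ_eq (N - 1) k
    rw [Nat.sub_add_cancel hN] at this
    rw [← Nat.cast_sub hk, mul_comm]
    exact_mod_cast this
  have hc : (0 : ℝ) < N.choose k := by exact_mod_cast Nat.choose_pos hk
  have hg : centroidParam N k = N + 1 + (√(k + 1) - 1) * (N - k) := by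
    unfold centroidParam
    ring
  have hg0 : centroidParam N k ≠ 0 := (zero_lt_one.trans_le (one_le_centroidParam hk)).ne'
  have hden : ((k : ℝ) + 1) * ((N + 1).choose (k + 1) + (√(k + 1) - 1) * N.choose (k + 1)) =
      N.choose k * centroidParam N k := by
    rw [hg]
    linear_combination h₁ + (√((k : ℝ) + 1) - 1) * h₂
  have hN0 : (N : ℝ) ≠ 0 := by exact_mod_cast hN.ne'
  have hnum : (N.choose k + (√((k : ℝ) + 1) - 1) * (N - 1).choose k : ℝ) * N =
      N.choose k * (centroidParam N k - 1) := by
    rw [hg]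
    linear_combination (√((k : ℝ) + 1) - 1) * h₃
  rw [hden, ← div_eq_inv_mul, div_eq_div_iff (by positivity) hN0, hnum]
  field_simp

theorem skeletonCentroid_eq_iff {N k l : ℕ} (hN : 0 < N) (hk : k ≤ N) (hl : l ≤ N) :
    skeletonCentroid N k = skeletonCentroid N l ↔ centroidParam N k = centroidParam N l := by
  refine ⟨fun h => ?_, fun h => ?_⟩
  · have hi := congrArg (fun x : EuclideanSpace ℝ (Fin N) => x ⟨0, hN⟩) h
    simp only [skeletonCentroid_apply hk, skeletonCentroid_apply hl] at hi
    rw [div_left_inj' (by exact_mod_cast hN.ne'), sub_right_inj] at hi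
    exact inv_injective hi
  · ext i
    rw [skeletonCentroid_apply hk, skeletonCentroid_apply hl, h]

theorem isSquare_of_mul_sqrt_eq {a : ℕ} {m n : ℤ} (hn : n ≠ 0) (h : n * √(a : ℝ) = m) :
    IsSquare a := by
  by_contra hsq
  refine irrational_sqrt_natCast_iff.mpr hsq ⟨m / n, ?_⟩
  have : (n : ℝ) ≠ 0 := by exact_mod_cast hn
  push_cast
  rw [← h]
  field_simp

theorem eq_four_or_nine_of_isSquare {a : ℕ} (ha : IsSquare a) (h₂ : 2 ≤ a) (h₁₂ : a ≤ 12) :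
    a = 4 ∨ a = 9 := by
  obtain ⟨r, rfl⟩ := ha
  have : r ≤ 3 := by nlinarith
  interval_cases r <;> simp_all

theorem centroidParam_ne_of_lt {N k l : ℕ} (hN : N ≤ 12) (hk : 1 ≤ k) (hkl : k < l) (hl : l < N) :
    centroidParam N k ≠ centroidParam N l := by
  intro h
  have hk0 : (0 : ℝ) ≤ k := Nat.cast_nonneg k
  have hl0 : (0 : ℝ) ≤ l := Nat.cast_nonneg l
  have hp : √((k : ℝ) + 1) ^ 2 = k + 1 := Real.sq_sqrt (by linarith)
  have hq : √((l : ℝ) + 1) ^ 2 = l + 1 := Real.sq_sqrt (by linarith)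
  have hpq : √((k : ℝ) + 1) < √((l : ℝ) + 1) :=
    Real.sqrt_lt_sqrt (by linarith) (by exact_mod_cast Nat.succ_lt_succ hkl)
  unfold centroidParam at h
  have key : (√((k : ℝ) + 1) - 1) * (√((l : ℝ) + 1) - 1) = N - k - l := by
    refine mul_left_cancel₀ (sub_ne_zero.mpr hpq.ne) ?_
    linear_combination -h + (√((l : ℝ) + 1) - 1) * hp - (√((k : ℝ) + 1) - 1) * hq
  have hksq : IsSquare (k + 1) := by
    refine isSquare_of_mul_sqrt_eq (n := 2 * (N - k))
      (m := (l + 1) * (k + 2) - (N - k - l - 1) ^ 2 - (k + 1)) (by omega) ?_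
    push_cast
    linear_combination (-(√((l : ℝ) + 1) * (√((k : ℝ) + 1) - 1) + (N - k - l - 1 + √((k : ℝ) + 1)))) * key +
      (√((k : ℝ) + 1) - 1) ^ 2 * hq + (l : ℝ) * hp
  have hlsq : IsSquare (l + 1) := by
    refine isSquare_of_mul_sqrt_eq (n := 2 * (N - l))
      (m := (k + 1) * (l + 2) - (N - k - l - 1) ^ 2 - (l + 1)) (by omega) ?_
    push_cast
    linear_combination (-(√((k : ℝ) + 1) * (√((l : ℝ) + 1) - 1) + (N - k - l - 1 + √((l : ℝ) + 1)))) * key +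
      (√((l : ℝ) + 1) - 1) ^ 2 * hp + (k : ℝ) * hq
  have hk' := eq_four_or_nine_of_isSquare hksq (by omega) (by omega)
  have hl' := eq_four_or_nine_of_isSquare hlsq (by omega) (by omega)
  obtain rfl : k = 3 := by omega
  obtain rfl : l = 8 := by omega
  have h₂ : √(((3 : ℕ) : ℝ) + 1) = 2 := by
    rw [Real.sqrt_eq_iff_mul_self_eq_of_pos] <;> norm_num
  have h₃ : √(((8 : ℕ) : ℝ) + 1) = 3 := by
    rw [Real.sqrt_eq_iff_mul_self_eq_of_pos] <;> norm_num
  rw [h₂, h₃] at key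
  have : (N : ℝ) = 13 := by
    push_cast at key
    linarith
  have : N = 13 := by exact_mod_cast this
  omega

theorem centroidParam_zero (N : ℕ) : centroidParam N 0 = N + 1 := by
  simp [centroidParam]
  ring

theorem centroidParam_self (N : ℕ) : centroidParam N N = N + 1 := by
  simp [centroidParam]

theorem lt_centroidParam {N k : ℕ} (hk : 1 ≤ k) (hkN : k < N) : (N : ℝ) + 1 < centroidParam N k := by
  have h₁ : (1 : ℝ) < √(k + 1) := by
    rw [Real.lt_sqrt zero_le_one]
    have : (1 : ℝ) ≤ k := by exact_mod_cast hk
    linarith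
  have h₂ : (0 : ℝ) < N - k := sub_pos.mpr (by exact_mod_cast hkN)
  unfold centroidParam
  nlinarith [mul_pos (sub_pos.mpr h₁) h₂]

/-- For every `N` with `2 ≤ N ≤ 12`, the centroids of the intermediate skeletons
`S_1, …, S_{N-1}` of the standard simplex in `ℝ^N` are pairwise distinct, and each of
them differs from the common centroid `C_{0,N} = C_{N,N}` of the vertex set and the
solid simplex. -/
theorem intermediate_centroids_distinct (N : ℕ) (hN : 2 ≤ N) (hN' : N ≤ 12) :
    skeletonCentroid N 0 = skeletonCentroid N N ∧
    (∀ k₁ k₂ : ℕ, 1 ≤ k₁ → k₁ < k₂ → k₂ ≤ N - 1 →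
      skeletonCentroid N k₁ ≠ skeletonCentroid N k₂) ∧
    (∀ k : ℕ, 1 ≤ k → k ≤ N - 1 → skeletonCentroid N k ≠ skeletonCentroid N 0) := by
  refine ⟨?_, fun k l hk hkl hl => ?_, fun k hk hkN => ?_⟩
  · rw [skeletonCentroid_eq_iff (by omega) (by omega) le_rfl, centroidParam_zero,
      centroidParam_self]
  · rw [Ne, skeletonCentroid_eq_iff (by omega) (by omega) (by omega)]
    exact centroidParam_ne_of_lt hN' hk hkl (by omega)
  · rw [Ne, skeletonCentroid_eq_iff (by omega) (by omega) (by omega), centroidParam_zero]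
    exact (lt_centroidParam hk (by omega)).ne'
end
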